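/- arXiv:1705.04609 — 4 statements merged into one kernel-verified Lean document; each statement's English description precedes it below -/
import Mathlib

section
/- Let φ : ℕ → ℕ be a nondecreasing function, let ρ ≥ 3, and let G be a (ρ,φ)-controlled graph. Let τ ≥ 0 be such that χ^{ρ−1}(G) ≤ τ and χ(J) ≤ τ for every induced subgraph J of G with ω(J) < ω(G). Let c ≥ 0 and let (W_1, …, W_n) be a τ-colourable grading of G. Let H be a subgraph of G (not necessarily induced) with χ(H) > τ + 1 + φ(c + τ), such that W_i ∩ V(H) is a stable set of H for each i. Then there is an edge uv of H and a ρ-ball X of G such that: u and v are both earlier than every vertex of X; v has a G-neighbour in X and u does not; and χ(G[X]) > c. -/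
open SimpleGraph

variable {V : Type*}

/-- The set of vertices at `G`-distance at most `ρ` from `v`. -/
def closedNbhd (G : SimpleGraph V) (v : V) (ρ : ℕ) : Set V :=
  {u | G.Reachable v u ∧ G.dist v u ≤ ρ}

/-- `χ^ρ(G)`. -/
noncomputable def chiRho (G : SimpleGraph V) (ρ : ℕ) : ℕ∞ :=
  ⨆ v : V, (G.induce (closedNbhd G v ρ)).chromaticNumber

/-- `G` is `(ρ,φ)`-controlled. -/
def Controlled (ρ : ℕ) (φ : ℕ → ℕ) (G : SimpleGraph V) : Prop :=
  ∀ X : Set V, (G.induce X).chromaticNumber ≤ (φ (chiRho (G.induce X) ρ).toNat : ℕ∞)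

/-- `W` is a grading of the set `U` of vertices of `G`: pairwise disjoint sets
with union `U`. -/
def IsGrading (U : Set V) {n : ℕ} (W : Fin n → Set V) : Prop :=
  (⋃ i, W i) = U ∧ ∀ i j, i ≠ j → Disjoint (W i) (W j)

/-- `u` is earlier than `v` with respect to the grading `W`. -/
def Earlier {n : ℕ} (W : Fin n → Set V) (u v : V) : Prop :=
  ∃ i j, i < j ∧ u ∈ W i ∧ v ∈ W j

/-- `X` is a `ρ`-ball of `G`: empty, or with a centre `z` such that every vertex of
`G[X]` is at `G[X]`-distance at most `ρ` from `z`. -/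
def IsBall (G : SimpleGraph V) (ρ : ℕ) (X : Set V) : Prop :=
  X = ∅ ∨ ∃ z : X, ∀ u : X, (G.induce X).Reachable z u ∧ (G.induce X).dist z u ≤ ρ

open Classical in
theorem colorable_induce_iff (G : SimpleGraph V) (S : Set V) (n : ℕ) :
    (G.induce S).Colorable n ↔ ∃ f : V → ℕ, (∀ v ∈ S, f v < n) ∧
      ∀ u ∈ S, ∀ v ∈ S, G.Adj u v → f u ≠ f v := by
  constructor
  · rintro ⟨f⟩
    refine ⟨fun v => if h : v ∈ S then f ⟨v, h⟩ else 0, fun v hv => ?_, fun u hu v hv huv => ?_⟩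
    · simp [hv]
    · have : f ⟨u, hu⟩ ≠ f ⟨v, hv⟩ := f.valid huv
      simpa [hu, hv, Fin.val_inj] using this
  · rintro ⟨f, hf, hadj⟩
    refine ⟨Coloring.mk (fun v => ⟨f v, hf v v.2⟩) fun {u v} huv h => ?_⟩
    exact hadj u u.2 v v.2 huv (by simpa using h)

open Classical in
theorem colorable_induce_of_subset_union {G : SimpleGraph V} {S A B : Set V} {a b : ℕ}
    (hS : S ⊆ A ∪ B) (hA : (G.induce A).Colorable a) (hB : (G.induce B).Colorable b) :
    (G.induce S).Colorable (a + b) := by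
  rw [colorable_induce_iff] at *
  obtain ⟨f, hf, hf'⟩ := hA
  obtain ⟨g, hg, hg'⟩ := hB
  refine ⟨fun v => if v ∈ A then f v else a + g v, fun v hv => ?_, fun u hu v hv huv => ?_⟩
  · by_cases h : v ∈ A
    · have := hf v h
      simp only [h, if_true]
      omega
    · have := hg v ((hS hv).resolve_left h)
      simp only [h, if_false]
      omega
  · by_cases h : u ∈ A <;> by_cases h' : v ∈ A <;> simp only [h, h', if_true, if_false]
    · exact hf' u h v h' huv
    · have := hf u h
      omega
    · have := hf v h'
      omega
    · have := hg' u ((hS hu).resolve_left h) v ((hS hv).resolve_left h') huv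
      omega

theorem colorable_induce_closedNbhd {G : SimpleGraph V} {r τ : ℕ}
    (h : chiRho G r ≤ (τ : ℕ∞)) (v : V) : (G.induce (closedNbhd G v r)).Colorable τ :=
  chromaticNumber_le_iff_colorable.1
    ((le_iSup (fun v => (G.induce (closedNbhd G v r)).chromaticNumber) v).trans h)

theorem mem_closedNbhd_of_walk {G : SimpleGraph V} {u v : V} {r : ℕ} (p : G.Walk v u)
    (hp : p.length ≤ r) : u ∈ closedNbhd G v r :=
  ⟨p.reachable, (dist_le p).trans hp⟩

/-- The vertices reachable from `z` by a walk of length at most `r` inside `S`. -/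
def walkBall (G : SimpleGraph V) (S : Set V) (z : V) (r : ℕ) : Set V :=
  {w | ∃ p : G.Walk z w, (∀ y ∈ p.support, y ∈ S) ∧ p.length ≤ r}

theorem walkBall_subset (G : SimpleGraph V) (S : Set V) (z : V) (r : ℕ) :
    walkBall G S z r ⊆ S :=
  fun _ ⟨p, hp, _⟩ => hp _ p.end_mem_support

open Classical in
theorem mem_walkBall_takeUntil {G : SimpleGraph V} {S : Set V} {z w y : V} {p : G.Walk z w}
    (hp : ∀ y ∈ p.support, y ∈ S) (hy : y ∈ p.support) :
    y ∈ walkBall G S z (p.takeUntil y hy).length :=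
  ⟨p.takeUntil y hy, fun _ hx => hp _ (p.support_takeUntil_subset_support hy hx), le_rfl⟩

theorem length_induce {G : SimpleGraph V} {S : Set V} {u v : V} (p : G.Walk u v)
    (hp : ∀ x ∈ p.support, x ∈ S) : (p.induce S hp).length = p.length := by
  induction p with
  | nil => rfl
  | cons h p ih => simp [ih]

theorem mem_walkBall_of_induce {G : SimpleGraph V} {S : Set V} {r : ℕ} {z w : S}
    (h : w ∈ closedNbhd (G.induce S) z r) : (w : V) ∈ walkBall G S z r := by
  obtain ⟨hr, hd⟩ := h
  obtain ⟨p, hp⟩ := hr.exists_walk_length_eq_dist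
  rw [← hp] at hd
  clear hp hr
  induction p generalizing r with
  | @nil z => exact ⟨Walk.nil, by simp, by simp⟩
  | @cons a b _ hab p ih =>
    rw [Walk.length_cons] at hd
    obtain ⟨q, hq, hl⟩ := ih (r := r - 1) (by omega)
    have hab' : G.Adj a b := hab
    refine ⟨Walk.cons hab' q, fun y hy => ?_, ?_⟩
    · rw [Walk.support_cons, List.mem_cons] at hy
      exact hy.elim (fun h => h ▸ a.2) (hq y)
    · rw [Walk.length_cons]
      omega

open Classical in
theorem isBall_walkBall (G : SimpleGraph V) (S : Set V) (z : V) (r : ℕ) :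
    IsBall G r (walkBall G S z r) := by
  by_cases hz : z ∈ S
  · refine Or.inr ⟨⟨z, Walk.nil, by simpa using hz, by simp⟩, ?_⟩
    rintro ⟨w, p, hp, hl⟩
    have hq : ∀ y ∈ p.support, y ∈ walkBall G S z r := fun y hy => by
      obtain ⟨q, hq, hql⟩ := mem_walkBall_takeUntil hp hy
      exact ⟨q, hq, (hql.trans (p.length_takeUntil_le_length hy)).trans hl⟩
    exact ⟨(p.induce _ hq).reachable, (dist_le (p.induce _ hq)).trans
      ((length_induce p hq).trans_le hl)⟩
  · refine Or.inl (Set.eq_empty_of_forall_notMem ?_)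
    rintro w ⟨p, hp, -⟩
    exact hz (hp _ p.start_mem_support)

theorem IsBall.exists_subset_walkBall {G : SimpleGraph V} {X : Set V} {r : ℕ}
    (h : IsBall G r X) (hX : X.Nonempty) : ∃ z ∈ X, X ⊆ walkBall G X z r := by
  obtain rfl | ⟨z, hz⟩ := h
  · simp at hX
  · exact ⟨z, z.2, fun w hw => mem_walkBall_of_induce (w := ⟨w, hw⟩) (hz ⟨w, hw⟩)⟩

/-- If no edge `uv` of `H` inside `K` separates a ball inside `X` of chromatic number more
than `c`, then `K` is contained in a small ball of `G`. -/
theorem exists_subset_closedNbhd_of_not_separated {G H : SimpleGraph V} {ρ τ c : ℕ}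
    (hρ : 3 ≤ ρ) (hτ : chiRho G (ρ - 1) ≤ (τ : ℕ∞)) {X K : Set V}
    (hX : IsBall G ρ X) (hXc : ¬ (G.induce X).Colorable (c + τ))
    (hK : ∀ P : V → Prop, (∀ u ∈ K, ∀ v ∈ K, H.Adj u v → P u → P v) →
      ∀ u ∈ K, ∀ v ∈ K, P u → P v)
    (hsep : ∀ u ∈ K, ∀ v ∈ K, H.Adj u v → ∀ Y ⊆ X, IsBall G ρ Y →
      (∃ w ∈ Y, G.Adj v w) → (∀ w ∈ Y, ¬ G.Adj u w) → (G.induce Y).Colorable c)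
    (hadj : ∃ v ∈ K, ∃ x ∈ X, G.Adj v x) :
    ∃ x, K ⊆ closedNbhd G x (ρ - 1) := by
  classical
  obtain ⟨v₀, hv₀, x₀, hx₀, hvx₀⟩ := hadj
  obtain ⟨z, hz, hXz⟩ := hX.exists_subset_walkBall ⟨x₀, hx₀⟩
  by_cases hall : ∀ u ∈ K, ∃ x ∈ walkBall G X z 1, G.Adj u x
  · refine ⟨z, fun u hu => ?_⟩
    obtain ⟨x, ⟨p, -, hl⟩, hux⟩ := hall u hu
    refine mem_closedNbhd_of_walk (p.concat hux.symm) ?_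
    rw [Walk.length_concat]
    omega
  push Not at hall
  obtain ⟨u₁, hu₁, hfar₁⟩ := hall
  have hbig : ∀ u, (∀ x ∈ walkBall G X z 1, ¬ G.Adj u x) →
      ¬ (G.induce (walkBall G {w ∈ X | ¬ G.Adj u w} z ρ)).Colorable c := by
    intro u hu hcol
    refine hXc (colorable_induce_of_subset_union (fun w hw => ?_) hcol
      (colorable_induce_closedNbhd hτ u))
    by_contra hw'
    simp only [Set.mem_union, not_or] at hw'
    obtain ⟨p, hp, hl⟩ := hXz hw
    refine hw'.1 ⟨p, fun y hy => ⟨hp y hy, fun huy => hw'.2 ?_⟩, hl⟩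
    have h2 : 2 ≤ (p.takeUntil y hy).length := by
      by_contra hlt
      obtain ⟨q, hq, hql⟩ := mem_walkBall_takeUntil hp hy
      exact hu y ⟨q, hq, by omega⟩ huy
    have hlen := congrArg Walk.length (p.take_spec hy)
    rw [Walk.length_append] at hlen
    refine mem_closedNbhd_of_walk (Walk.cons huy (p.dropUntil y hy)) ?_
    rw [Walk.length_cons]
    omega
  have hnone : ∀ u ∈ K, ∀ v ∈ K, H.Adj u v → (∀ x ∈ walkBall G X z 1, ¬ G.Adj u x) →
      ∀ w ∈ walkBall G {w ∈ X | ¬ G.Adj u w} z ρ, ¬ G.Adj v w := by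
    intro u hu v hv huv hfar w hw hvw
    refine hbig u hfar (hsep u hu v hv huv _ (fun y hy => (walkBall_subset _ _ _ _ hy).1)
      (isBall_walkBall _ _ _ _) ⟨w, hw, hvw⟩ fun y hy => (walkBall_subset _ _ _ _ hy).2)
  have hfar : ∀ u ∈ K, ∀ x ∈ walkBall G X z 1, ¬ G.Adj u x := by
    intro u hu
    refine hK (fun u => ∀ x ∈ walkBall G X z 1, ¬ G.Adj u x) ?_ u₁ hu₁ u hu hfar₁
    rintro u hu v hv huv h x ⟨p, hp, hl⟩ hvx
    refine hnone u hu v hv huv h x ⟨p, fun y hy => ⟨hp y hy, h y ?_⟩, by omega⟩ hvx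
    obtain ⟨q, hq, hql⟩ := mem_walkBall_takeUntil hp hy
    exact ⟨q, hq, (hql.trans (p.length_takeUntil_le_length hy)).trans hl⟩
  have hex : ∃ k, ∃ u ∈ K, ∃ x ∈ walkBall G X z k, G.Adj u x :=
    ⟨ρ, v₀, hv₀, x₀, hXz hx₀, hvx₀⟩
  obtain ⟨u, hu, x, ⟨p, hp, hl⟩, hux⟩ := Nat.find_spec hex
  have hkρ : Nat.find hex ≤ ρ := Nat.find_min' hex ⟨v₀, hv₀, x₀, hXz hx₀, hvx₀⟩
  have hmin : ∀ w ∈ K, ∀ y ∈ p.support, G.Adj w y → y = x := by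
    intro w hw y hy hwy
    by_contra hne
    have hlt := p.length_takeUntil_lt_length hy hne
    exact Nat.find_min hex (hlt.trans_le hl) ⟨w, hw, y, mem_walkBall_takeUntil hp hy, hwy⟩
  refine ⟨x, fun v hv => ?_⟩
  have hvx : G.Adj v x := by
    refine hK (fun v => G.Adj v x) ?_ u hu v hv hux
    intro u hu v hv huv hux
    by_contra hvx
    refine hnone v hv u hu huv.symm (hfar v hv) x
      ⟨p, fun y hy => ⟨hp y hy, fun hvy => hvx ?_⟩, hl.trans hkρ⟩ hux
    exact hmin v hv y hy hvy ▸ hvy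
  refine mem_closedNbhd_of_walk (Walk.cons hvx.symm Walk.nil) ?_
  simp only [Walk.length_cons, Walk.length_nil]
  omega

theorem colorable_induce_of_forall_ball {G : SimpleGraph V} {φ : ℕ → ℕ} (hφ : Monotone φ)
    {ρ m : ℕ} (hG : Controlled ρ φ G) {N : Set V}
    (hN : ∀ X ⊆ N, IsBall G ρ X → (G.induce X).Colorable m) :
    (G.induce N).Colorable (φ m) := by
  have hle : chiRho (G.induce N) ρ ≤ (m : ℕ∞) := by
    refine iSup_le fun v => chromaticNumber_le_iff_colorable.2 ?_
    let g : (G.induce N).induce (closedNbhd (G.induce N) v ρ) →g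
        G.induce (walkBall G N v ρ) :=
      ⟨fun w => ⟨w.1.1, mem_walkBall_of_induce w.2⟩, fun h => h⟩
    exact (hN _ (walkBall_subset G N v ρ) (isBall_walkBall G N v ρ)).of_hom g
  refine chromaticNumber_le_iff_colorable.1 ((hG N).trans ?_)
  exact_mod_cast hφ (ENat.toNat_le_of_le_natCast hle)

theorem IsGrading.exists_index {n : ℕ} {W : Fin n → Set V} (h : IsGrading Set.univ W) :
    ∃ f : V → Fin n, ∀ v, v ∈ W (f v) := by
  have : ∀ v, ∃ i, v ∈ W i := fun v => by
    have hv : v ∈ ⋃ i, W i := h.1 ▸ Set.mem_univ v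
    simpa using hv
  exact Classical.skolem.1 this

theorem connectedComponent_supp_propagate {H : SimpleGraph V} {R : Set V}
    (C : (H.induce R).ConnectedComponent) (P : V → Prop)
    (hP : ∀ u ∈ Subtype.val '' C.supp, ∀ v ∈ Subtype.val '' C.supp, H.Adj u v → P u → P v) :
    ∀ u ∈ Subtype.val '' C.supp, ∀ v ∈ Subtype.val '' C.supp, P u → P v := by
  rintro _ ⟨u, hu, rfl⟩ _ ⟨v, hv, rfl⟩ hPu
  obtain ⟨p⟩ := C.reachable_of_mem_supp hu hv
  clear hv
  induction p with
  | nil => exact hPu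
  | @cons a b _ hab p ih =>
    have hb : b ∈ C.supp := (C.mem_supp_congr_adj hab).1 hu
    exact ih hb (hP a ⟨a, hu, rfl⟩ b ⟨b, hb, rfl⟩ hab hPu)

theorem stmt12 (φ : ℕ → ℕ) (hφ : Monotone φ) (ρ : ℕ) (hρ : 3 ≤ ρ) (τ c : ℕ)
    {V : Type*} [Fintype V] (G : SimpleGraph V) (hG : Controlled ρ φ G)
    (hτ1 : chiRho G (ρ - 1) ≤ (τ : ℕ∞))
    (hτ2 : ∀ Y : Set V, (G.induce Y).cliqueNum < G.cliqueNum →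
      (G.induce Y).chromaticNumber ≤ (τ : ℕ∞))
    (n : ℕ) (W : Fin n → Set V) (hgrad : IsGrading Set.univ W)
    (hcol : ∀ i, (G.induce (W i)).chromaticNumber ≤ (τ : ℕ∞))
    (H : SimpleGraph V) (hHG : H ≤ G)
    (hchiH : ((τ + 1 + φ (c + τ) : ℕ) : ℕ∞) < H.chromaticNumber)
    (hstab : ∀ i : Fin n, ∀ u ∈ W i, ∀ v ∈ W i, ¬ H.Adj u v) :
    ∃ u v, H.Adj u v ∧ ∃ X : Set V, IsBall G ρ X ∧
      (∀ w ∈ X, Earlier W u w ∧ Earlier W v w) ∧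
      (∃ w ∈ X, G.Adj v w) ∧ (∀ w ∈ X, ¬ G.Adj u w) ∧
      (c : ℕ∞) < (G.induce X).chromaticNumber := by
  classical
  obtain ⟨f, hf⟩ := hgrad.exists_index
  by_contra hno
  have hsep : ∀ u v, H.Adj u v → ∀ Y, IsBall G ρ Y → (∀ w ∈ Y, f u < f w ∧ f v < f w) →
      (∃ w ∈ Y, G.Adj v w) → (∀ w ∈ Y, ¬ G.Adj u w) → (G.induce Y).Colorable c := by
    intro u v huv Y hY hlater hv hu
    by_contra hc
    refine hno ⟨u, v, huv, Y, hY, fun w hw => ?_, hv, hu, ?_⟩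
    · exact ⟨⟨f u, f w, (hlater w hw).1, hf u, hf w⟩, ⟨f v, f w, (hlater w hw).2, hf v, hf w⟩⟩
    · exact not_le.1 fun h => hc (chromaticNumber_le_iff_colorable.1 h)
  refine not_le.2 hchiH (chromaticNumber_le_iff_colorable.2 ?_)
  set R : Set V := {v | ∃ X, IsBall G ρ X ∧ ¬ (G.induce X).Colorable (c + τ) ∧
    (∀ w ∈ X, f v < f w) ∧ ∃ w ∈ X, G.Adj v w} with hR
  set T : Set V := {v | v ∉ R ∧ ∃ X, IsBall G ρ X ∧ ¬ (G.induce X).Colorable (c + τ) ∧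
    v ∈ X ∧ ∀ w ∈ X, f v ≤ f w} with hT
  have hRcol : (H.induce R).Colorable τ := by
    refine colorable_iff_forall_connectedComponent.2 fun C => ?_
    set K : Set V := Subtype.val '' C.supp with hKdef
    have hKne : K.Nonempty := C.nonempty_supp.image _
    obtain ⟨v, hvK, hvmax⟩ := Set.exists_max_image K f K.toFinite hKne
    obtain ⟨⟨v, hvR⟩, hvC, rfl⟩ := hvK
    obtain ⟨X, hX, hXc, hlater, hadj⟩ := hvR
    obtain ⟨x, hx⟩ := exists_subset_closedNbhd_of_not_separated (H := H) hρ hτ1 hX hXc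
      (connectedComponent_supp_propagate C)
      (fun a ha b hb hab Y hYX hY => hsep a b hab Y hY fun w hw =>
        ⟨(hvmax a ha).trans_lt (hlater w (hYX hw)), (hvmax b hb).trans_lt (hlater w (hYX hw))⟩)
      ⟨v, ⟨_, hvC, rfl⟩, hadj⟩
    let g : C.toSimpleGraph →g G.induce (closedNbhd G x (ρ - 1)) :=
      ⟨fun w => ⟨w.1.1, hx ⟨w.1, w.2, rfl⟩⟩, fun h => hHG h⟩
    exact (colorable_induce_closedNbhd hτ1 x).of_hom g
  have hTcol : (H.induce T).Colorable 1 := by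
    have key : ∀ u ∈ T, ∀ v ∈ T, H.Adj u v → ¬ f u < f v := by
      rintro u hu v ⟨-, X, hX, hXc, hvX, hle⟩ huv hlt
      exact hu.1 ⟨X, hX, hXc, fun w hw => hlt.trans_le (hle w hw), v, hvX, hHG huv⟩
    rw [colorable_induce_iff]
    refine ⟨fun _ => 0, fun _ _ => one_pos, fun u hu v hv huv _ => ?_⟩
    have heq : f u = f v :=
      le_antisymm (not_lt.1 (key v hv u hu huv.symm)) (not_lt.1 (key u hu v hv huv))
    exact hstab (f u) u (hf u) v (heq ▸ hf v) huv
  have hNcol : (H.induce (R ∪ T)ᶜ).Colorable (φ (c + τ)) := by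
    refine Colorable.mono_left (fun _ _ h => hHG h : H.induce (R ∪ T)ᶜ ≤ G.induce (R ∪ T)ᶜ)
      (colorable_induce_of_forall_ball hφ hG fun X hXN hX => ?_)
    by_contra hXc
    have hne : X.Nonempty := by
      by_contra hemp
      rw [Set.not_nonempty_iff_eq_empty] at hemp
      subst hemp
      exact hXc (.of_isEmpty _)
    obtain ⟨v, hvX, hvmin⟩ := Set.exists_min_image X f X.toFinite hne
    have hvN := hXN hvX
    exact hvN (Or.inr ⟨fun h => hvN (Or.inl h), X, hX, hXc, hvX, hvmin⟩)
  have huniv : (H.induce Set.univ).Colorable (τ + 1 + φ (c + τ)) :=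
    colorable_induce_of_subset_union (Set.union_compl_self (R ∪ T)).ge
      (colorable_induce_of_subset_union le_rfl hRcol hTcol) hNcol
  exact huniv.of_hom (f := (⟨fun v => ⟨v, trivial⟩, fun h => h⟩ : H →g H.induce Set.univ))
end

section
/- Let φ : ℕ → ℕ be a nondecreasing function, let ρ ≥ 3, and let G be a (ρ,φ)-controlled graph. Let τ ≥ 0 be such that χ^{ρ−1}(G) ≤ τ and χ(J) ≤ τ for every induced subgraph J of G with ω(J) < ω(G). Let B, C ⊆ V(G) with B covering C, and let the enumeration (b_1, …, b_m) of B and the grading (W_1, …, W_n) of G[C] be compatible, with (W_1, …, W_n) τ-colourable. If χ(G[C]) > τ²(τ + 1 + φ(c + τ)), then there is a square edge uv of G[C] and a ρ-ball X of G such that: u and v are both earlier than every vertex of X; v has a neighbour in X and u does not; and χ(G[X]) > c. -/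
open SimpleGraph

variable {V : Type*}

/-- `B` covers `C`: they are disjoint and every vertex of `C` has a neighbour in `B`. -/
def Covers (G : SimpleGraph V) (B C : Set V) : Prop :=
  Disjoint B C ∧ ∀ v ∈ C, ∃ b ∈ B, G.Adj b v

/-- `b i` is the earliest parent of `v` w.r.t. the enumeration `b`. -/
def EarliestParent (G : SimpleGraph V) {m : ℕ} (b : Fin m → V) (v : V) (i : Fin m) : Prop :=
  G.Adj (b i) v ∧ ∀ j, j < i → ¬ G.Adj (b j) v

/-- `uv` is a square edge w.r.t. the enumeration `b`. -/
def SquareEdge (G : SimpleGraph V) {m : ℕ} (b : Fin m → V) (u v : V) : Prop :=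
  G.Adj u v ∧ ∀ i j, EarliestParent G b u i → EarliestParent G b v j →
    ¬ G.Adj (b i) v ∧ ¬ G.Adj (b j) u

/-- The enumeration `b` of `B` and the grading `W` of `C` are compatible. -/
def CompatibleEnum (G : SimpleGraph V) {m n : ℕ} (b : Fin m → V) (W : Fin n → Set V)
    (C : Set V) : Prop :=
  ∀ u ∈ C, ∀ v ∈ C, Earlier W u v →
    ∀ i j, EarliestParent G b u i → EarliestParent G b v j → i < j

lemma induce_colorable_iff (G : SimpleGraph V) (X : Set V) (k : ℕ) :
    (G.induce X).Colorable k ↔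
      ∃ f : V → ℕ, (∀ x ∈ X, f x < k) ∧ ∀ x ∈ X, ∀ y ∈ X, G.Adj x y → f x ≠ f y := by
  classical
  rw [colorable_iff_exists_bdd_nat_coloring]
  constructor
  · rintro ⟨f, hf⟩
    refine ⟨fun x => if h : x ∈ X then f ⟨x, h⟩ else 0, ?_, ?_⟩
    · intro x hx
      simpa [hx] using hf ⟨x, hx⟩
    · intro x hx y hy hxy
      have : (G.induce X).Adj ⟨x, hx⟩ ⟨y, hy⟩ := hxy
      simpa [hx, hy] using f.valid this
  · rintro ⟨f, hf, hadj⟩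
    exact ⟨Coloring.mk (fun x => f x) fun {x y} h => hadj x x.2 y y.2 h, fun x => hf x x.2⟩

lemma colorable_induce_mono {G H : SimpleGraph V} {X Y : Set V} {k l : ℕ} (hGH : G ≤ H)
    (hXY : X ⊆ Y) (hkl : k ≤ l) (h : (H.induce Y).Colorable k) : (G.induce X).Colorable l := by
  rw [induce_colorable_iff] at h ⊢
  obtain ⟨f, hf, hadj⟩ := h
  exact ⟨f, fun x hx => (hf x (hXY hx)).trans_le hkl,
    fun x hx y hy hxy => hadj x (hXY hx) y (hXY hy) (hGH hxy)⟩

lemma colorable_induce_union {G : SimpleGraph V} {X Y : Set V} {k l : ℕ}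
    (hX : (G.induce X).Colorable k) (hY : (G.induce Y).Colorable l) :
    (G.induce (X ∪ Y)).Colorable (k + l) := by
  classical
  rw [induce_colorable_iff] at hX hY ⊢
  obtain ⟨f, hf, hfadj⟩ := hX
  obtain ⟨g, hg, hgadj⟩ := hY
  have hcase : ∀ x ∈ X ∪ Y, x ∉ X → x ∈ Y := fun x hx hn => hx.resolve_left hn
  refine ⟨fun x => if x ∈ X then f x else k + g x, ?_, ?_⟩
  · intro x hx
    by_cases h : x ∈ X
    · have := hf x h
      simp only [h, if_true]
      omega
    · have := hg x (hcase x hx h)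
      simp only [h, if_false]
      omega
  · intro x hx y hy hxy
    by_cases h : x ∈ X <;> by_cases h' : y ∈ X <;> simp only [h, h', if_true, if_false]
    · exact hfadj x h y h' hxy
    · have := hf x h
      omega
    · have := hf y h'
      omega
    · have := hgadj x (hcase x hx h) y (hcase y hy h') hxy
      omega

lemma colorable_induce_of_fibers {G : SimpleGraph V} {X : Set V} {k l : ℕ} (f : V → ℕ)
    (hf : ∀ x ∈ X, f x < k) (h : ∀ i, (G.induce {x ∈ X | f x = i}).Colorable l) :
    (G.induce X).Colorable (k * l) := by
  simp only [induce_colorable_iff] at h ⊢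
  choose g hg hadj using h
  refine ⟨fun x => l * f x + g (f x) x, ?_, ?_⟩
  · intro x hx
    have h1 := hf x hx
    have h2 := hg (f x) x ⟨hx, rfl⟩
    calc l * f x + g (f x) x < l * f x + l := by omega
      _ = (f x + 1) * l := by ring
      _ ≤ k * l := Nat.mul_le_mul_right _ h1
  · intro x hx y hy hxy heq
    have hx2 := hg (f x) x ⟨hx, rfl⟩
    have hy2 := hg (f y) y ⟨hy, rfl⟩
    have hl : 0 < l := by omega
    have hfx : f x = f y := by
      have := congrArg (· / l) heq
      simpa [Nat.mul_add_div hl, Nat.div_eq_of_lt hx2, Nat.div_eq_of_lt hy2] using this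
    refine hadj (f x) x ⟨hx, rfl⟩ y ⟨hy, hfx.symm⟩ hxy ?_
    simp only [hfx] at heq ⊢
    omega

/-- To colour `S` on `R`, it suffices to colour each subset of `R` on which `S` is connected. -/
lemma colorable_induce_of_connected {S : SimpleGraph V} {R : Set V} {k : ℕ}
    (h : ∀ K ⊆ R, (∀ P : V → Prop, (∀ u ∈ K, ∀ v ∈ K, S.Adj u v → P u → P v) →
      ∀ u ∈ K, ∀ v ∈ K, P u → P v) → (S.induce K).Colorable k) :
    (S.induce R).Colorable k := by
  rw [colorable_iff_forall_connectedComponent]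
  intro c
  have hK := h (Subtype.val '' c.supp) (by rintro _ ⟨x, -, rfl⟩; exact x.2) ?_
  · refine hK.of_hom ⟨fun x => ⟨x.1.1, x.1, x.2, rfl⟩, fun {x y} hxy => hxy⟩
  · rintro P hP _ ⟨u, hu, rfl⟩ _ ⟨v, hv, rfl⟩ hPu
    obtain ⟨p⟩ := c.reachable_of_mem_supp hu hv
    induction p with
    | nil => exact hPu
    | @cons u w v huw p ih =>
      have hw : w ∈ c.supp := (c.mem_supp_congr_adj huw).1 hu
      exact ih hw hv (hP _ ⟨u, hu, rfl⟩ _ ⟨w, hw, rfl⟩ huw hPu)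

/-- The vertices joined to `z` by a walk of length at most `k` inside `X`. -/
def ballWithin (G : SimpleGraph V) (X : Set V) (z : V) : ℕ → Set V
  | 0 => {x | x = z ∧ z ∈ X}
  | k + 1 => ballWithin G X z k ∪ {x | x ∈ X ∧ ∃ y ∈ ballWithin G X z k, G.Adj y x}

lemma ballWithin_mono (G : SimpleGraph V) (X : Set V) (z : V) : Monotone (ballWithin G X z) :=
  monotone_nat_of_le_succ fun _ => Set.subset_union_left

lemma ballWithin_subset (G : SimpleGraph V) (X : Set V) (z : V) (k : ℕ) :
    ballWithin G X z k ⊆ X := by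
  induction k with
  | zero => rintro x ⟨rfl, h⟩; exact h
  | succ k ih => exact Set.union_subset ih fun x hx => hx.1

lemma ballWithin_subset_of_subset (G : SimpleGraph V) {X Y : Set V} (h : X ⊆ Y) (z : V) (k : ℕ) :
    ballWithin G X z k ⊆ ballWithin G Y z k := by
  induction k with
  | zero => rintro x ⟨rfl, hx⟩; exact ⟨rfl, h hx⟩
  | succ k ih =>
    rintro x (hx | ⟨hx, y, hy, hyx⟩)
    · exact Or.inl (ih hx)
    · exact Or.inr ⟨h hx, y, ih hy, hyx⟩

lemma ballWithin_subset_self (G : SimpleGraph V) (X : Set V) (z : V) {k l : ℕ} (h : k ≤ l) :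
    ballWithin G X z k ⊆ ballWithin G (ballWithin G X z l) z k := by
  induction k with
  | zero => rintro x ⟨rfl, hx⟩; exact ⟨rfl, ballWithin_mono G X x h ⟨rfl, hx⟩⟩
  | succ k ih =>
    intro x hx
    have hxl := ballWithin_mono G X z h hx
    obtain hx | ⟨-, y, hy, hyx⟩ := hx
    · exact Or.inl (ih (by omega) hx)
    · exact Or.inr ⟨hxl, y, ih (by omega) hy, hyx⟩

lemma mem_ballWithin_iff (G : SimpleGraph V) (X : Set V) (z x : X) (k : ℕ) :
    x.1 ∈ ballWithin G X z k ↔ (G.induce X).Reachable z x ∧ (G.induce X).dist z x ≤ k := by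
  constructor
  · intro h
    suffices ∃ p : (G.induce X).Walk z x, p.length ≤ k by
      obtain ⟨p, hp⟩ := this
      exact ⟨p.reachable, (dist_le p).trans hp⟩
    induction k generalizing x with
    | zero =>
      obtain rfl : x = z := Subtype.ext h.1
      exact ⟨.nil, le_rfl⟩
    | succ k ih =>
      obtain hx | ⟨-, y, hy, hyx⟩ := h
      · obtain ⟨p, hp⟩ := ih x hx
        exact ⟨p, by omega⟩
      · obtain ⟨p, hp⟩ := ih ⟨y, ballWithin_subset _ _ _ _ hy⟩ hy
        have hadj : (G.induce X).Adj ⟨y, ballWithin_subset _ _ _ _ hy⟩ x := hyx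
        exact ⟨p.concat hadj, by rw [Walk.length_concat]; omega⟩
  · rintro ⟨hr, hd⟩
    obtain ⟨p, hp⟩ := hr.exists_walk_length_eq_dist
    rw [← hp] at hd
    clear hp hr
    refine ballWithin_mono G X z hd ?_
    clear hd
    induction p using Walk.concatRec with
    | Hnil => exact ⟨rfl, Subtype.prop _⟩
    | @Hconcat u v w p h ih =>
      rw [Walk.length_concat]
      exact Or.inr ⟨w.2, v, ih, h⟩

lemma ballWithin_univ_subset_closedNbhd (G : SimpleGraph V) (v : V) (k : ℕ) :
    ballWithin G Set.univ v k ⊆ closedNbhd G v k := by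
  suffices ∀ x ∈ ballWithin G Set.univ v k, ∃ p : G.Walk v x, p.length ≤ k by
    intro x hx
    obtain ⟨p, hp⟩ := this x hx
    exact ⟨p.reachable, (dist_le p).trans hp⟩
  intro x hx
  induction k generalizing x with
  | zero => obtain ⟨rfl, -⟩ := hx; exact ⟨.nil, le_rfl⟩
  | succ k ih =>
    obtain hx | ⟨-, y, hy, hyx⟩ := hx
    · obtain ⟨p, hp⟩ := ih x hx
      exact ⟨p, by omega⟩
    · obtain ⟨p, hp⟩ := ih y hy
      exact ⟨p.concat hyx, by rw [Walk.length_concat]; omega⟩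

lemma isBall_ballWithin (G : SimpleGraph V) {X : Set V} {z : V} (hz : z ∈ X) (ρ : ℕ) :
    IsBall G ρ (ballWithin G X z ρ) := by
  refine Or.inr ⟨⟨z, ballWithin_mono G X z (Nat.zero_le ρ) ⟨rfl, hz⟩⟩, fun u => ?_⟩
  rw [← mem_ballWithin_iff]
  exact ballWithin_subset_self G X z le_rfl u.2

lemma colorable_ballWithin_of_chiRho_le {G : SimpleGraph V} {r τ : ℕ} (h : chiRho G r ≤ τ)
    (v : V) : (G.induce (ballWithin G Set.univ v r)).Colorable τ := by
  refine colorable_induce_mono le_rfl (ballWithin_univ_subset_closedNbhd G v r) le_rfl ?_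
  rw [← chromaticNumber_le_iff_colorable]
  exact (le_iSup (fun v => (G.induce (closedNbhd G v r)).chromaticNumber) v).trans h

lemma Controlled.colorable_of_ballWithin {G : SimpleGraph V} {ρ k : ℕ} {φ : ℕ → ℕ}
    (hG : Controlled ρ φ G) (hφ : Monotone φ) {F : Set V}
    (h : ∀ z ∈ F, (G.induce (ballWithin G F z ρ)).Colorable k) :
    (G.induce F).Colorable (φ k) := by
  rw [← chromaticNumber_le_iff_colorable]
  refine (hG F).trans (Nat.cast_le.2 (hφ (ENat.toNat_le_of_le_natCast (iSup_le fun z => ?_))))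
  rw [chromaticNumber_le_iff_colorable]
  exact (h z z.2).of_hom ⟨fun x => ⟨x.1.1, (mem_ballWithin_iff G F z x.1 ρ).2 x.2⟩, fun h => h⟩

/-- Removing the neighbourhood of `u` from a ball loses only vertices close to `u`. -/
lemma mem_ballWithin_diff_neighborSet {G : SimpleGraph V} {X : Set V} {z u : V} {d : ℕ}
    (hu : ∀ w ∈ ballWithin G X z d, ¬ G.Adj u w) {k : ℕ} {x : V} (hx : x ∈ ballWithin G X z k) :
    x ∈ ballWithin G (X \ G.neighborSet u) z k ∨
      d + 1 ≤ k ∧ x ∈ ballWithin G Set.univ u (k - d) := by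
  induction k generalizing x with
  | zero =>
    obtain ⟨rfl, hxX⟩ := hx
    exact Or.inl ⟨rfl, hxX, hu x (ballWithin_mono G X x (Nat.zero_le d) ⟨rfl, hxX⟩)⟩
  | succ k ih =>
    have hx' := hx
    obtain hx | ⟨hxX, y, hy, hyx⟩ := hx
    · obtain h | ⟨h, h'⟩ := ih hx
      · exact Or.inl (Or.inl h)
      · exact Or.inr ⟨by omega, ballWithin_mono _ _ _ (by omega) h'⟩
    · obtain h | ⟨h, h'⟩ := ih hy
      · by_cases hux : G.Adj u x
        · have hdk : d + 1 ≤ k + 1 := by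
            by_contra hlt
            exact hu x (ballWithin_mono G X z (by omega) hx') hux
          refine Or.inr ⟨hdk, ballWithin_mono G Set.univ u (show 1 ≤ k + 1 - d by omega) ?_⟩
          exact Or.inr ⟨trivial, u, ⟨rfl, trivial⟩, hux⟩
        · exact Or.inl (Or.inr ⟨⟨hxX, hux⟩, y, h, hyx⟩)
      · refine Or.inr ⟨by omega, ?_⟩
        rw [show k + 1 - d = (k - d) + 1 by omega]
        exact Or.inr ⟨trivial, y, h', hyx⟩

/-- If every vertex of `K` has a neighbour in the ball `X`, and no large ball inside `X`
distinguishes two vertices of `K`, then `K` has small radius and hence small chromatic number. -/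
lemma colorable_of_attached_ball {G : SimpleGraph V} {ρ τ c : ℕ} (hρ : 3 ≤ ρ)
    (hτ : ∀ v, (G.induce (ballWithin G Set.univ v (ρ - 1))).Colorable τ)
    {K X : Set V} {z : V} (hz : z ∈ X) (hX : X ⊆ ballWithin G X z ρ)
    (hXc : ¬ (G.induce X).Colorable (c + τ))
    (hK : ∀ X' ⊆ X, IsBall G ρ X' → ¬ (G.induce X').Colorable c →
      ∀ u ∈ K, ∀ v ∈ K, (∃ w ∈ X', G.Adj v w) → ∃ w ∈ X', G.Adj u w)
    (hatt : ∀ u ∈ K, ∃ w ∈ X, G.Adj u w) : (G.induce K).Colorable τ := by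
  classical
  suffices ∃ v, K ⊆ ballWithin G Set.univ v 2 by
    obtain ⟨v, hv⟩ := this
    exact colorable_induce_mono le_rfl
      (hv.trans (ballWithin_mono G Set.univ v (by omega))) le_rfl (hτ v)
  let Far : ℕ → Prop := fun d => ∃ u ∈ K, ∀ w ∈ ballWithin G X z d, ¬ G.Adj u w
  by_cases h1 : Far 1
  · have hfar : ¬ Far ρ := by
      rintro ⟨u, hu, hfar⟩
      obtain ⟨w, hw, huw⟩ := hatt u hu
      exact hfar w (hX hw) huw
    obtain ⟨d, hd1, hdρ, ⟨u, hu, hud⟩, hd⟩ : ∃ d, 1 ≤ d ∧ d < ρ ∧ Far d ∧ ¬ Far (d + 1) := by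
      by_contra! hcon
      have : ∀ d, 1 ≤ d → d ≤ ρ → Far d := by
        intro d hd
        induction d, hd using Nat.le_induction with
        | base => exact fun _ => h1
        | succ d hd ih => exact fun hle => hcon d hd (by omega) (ih (by omega))
      exact hfar (this ρ (by omega) le_rfl)
    have hzu : z ∈ X \ G.neighborSet u :=
      ⟨hz, hud z (ballWithin_mono G X z (Nat.zero_le d) ⟨rfl, hz⟩)⟩
    have hX'sub := ballWithin_subset G (X \ G.neighborSet u) z ρ
    have hcol : ¬ (G.induce (ballWithin G (X \ G.neighborSet u) z ρ)).Colorable c := by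
      intro hcol
      refine hXc (colorable_induce_mono le_rfl (fun x hx => ?_) le_rfl
        (colorable_induce_union hcol (hτ u)))
      obtain h | ⟨-, h⟩ := mem_ballWithin_diff_neighborSet hud (hX hx)
      · exact Or.inl h
      · exact Or.inr (ballWithin_mono _ _ _ (by omega) h)
    refine ⟨u, fun v hv => ?_⟩
    obtain ⟨y, hy, hvy⟩ : ∃ y ∈ ballWithin G X z (d + 1), G.Adj v y := by
      by_contra! hcon
      exact hd ⟨v, hv, hcon⟩
    obtain h | ⟨-, h⟩ := mem_ballWithin_diff_neighborSet hud hy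
    · obtain ⟨w, hw, huw⟩ := hK _ (hX'sub.trans Set.sdiff_subset) (isBall_ballWithin G hzu ρ)
        hcol u hu v hv ⟨y, ballWithin_mono _ _ _ (by omega) h, hvy⟩
      exact absurd huw (hX'sub hw).2
    · rw [Nat.add_sub_cancel_left] at h
      exact Or.inr ⟨trivial, y, h, hvy.symm⟩
  · refine ⟨z, fun v hv => ?_⟩
    obtain ⟨y, hy, hvy⟩ : ∃ y ∈ ballWithin G X z 1, G.Adj v y := by
      by_contra! hcon
      exact h1 ⟨v, hv, hcon⟩
    exact Or.inr ⟨trivial, y, ballWithin_subset_of_subset G (Set.subset_univ X) z 1 hy, hvy.symm⟩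

lemma exists_earliestParent {G : SimpleGraph V} {m : ℕ} {b : Fin m → V} {C : Set V}
    (hcov : Covers G (Set.range b) C) {v : V} (hv : v ∈ C) : ∃ i, EarliestParent G b v i := by
  classical
  obtain ⟨_, ⟨i, rfl⟩, hi⟩ := hcov.2 v hv
  obtain ⟨j, hj, hmin⟩ := (Finset.univ.filter fun i => G.Adj (b i) v).exists_minimal
    ⟨i, by simpa using hi⟩
  simp only [Finset.mem_filter, Finset.mem_univ, true_and] at hj hmin
  exact ⟨j, hj, fun k hk hadj => absurd (hmin hadj hk.le) (not_le.2 hk)⟩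

lemma EarliestParent.le {G : SimpleGraph V} {m : ℕ} {b : Fin m → V} {v : V} {i j : Fin m}
    (h : EarliestParent G b v i) (hj : G.Adj (b j) v) : i ≤ j :=
  not_lt.1 fun hlt => h.2 j hlt hj

lemma SquareEdge.symm {G : SimpleGraph V} {m : ℕ} {b : Fin m → V} {u v : V}
    (h : SquareEdge G b u v) : SquareEdge G b v u :=
  ⟨h.1.symm, fun i j hi hj => (h.2 j i hj hi).symm⟩

/-- A clique without square edges extends by the latest of the earliest parents. -/
lemma cliqueNum_induce_lt_of_no_squareEdge [Finite V] {G : SimpleGraph V} {m : ℕ} {b : Fin m → V}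
    {C Z : Set V} (hcov : Covers G (Set.range b) C) (hZC : Z ⊆ C) (hne : Z.Nonempty)
    (hsq : ∀ u ∈ Z, ∀ v ∈ Z, ¬ SquareEdge G b u v) :
    (G.induce Z).cliqueNum < G.cliqueNum := by
  classical
  obtain ⟨s, hs⟩ := (G.induce Z).exists_isNClique_cliqueNum
  obtain ⟨z, hz⟩ := hne
  have hsne : s.Nonempty := by
    rw [← Finset.card_pos, hs.card_eq]
    have : (G.induce Z).IsClique (({⟨z, hz⟩} : Finset Z) : Set Z) := by simp
    simpa [Nat.succ_le_iff] using this.card_le_cliqueNum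
  choose p hp using fun v : Z => exists_earliestParent hcov (hZC v.2)
  obtain ⟨w, hw, hmax⟩ := s.exists_max_image p hsne
  have hadj : ∀ u ∈ s, G.Adj (b (p w)) u := by
    intro u hu
    by_contra hnadj
    have hne : u ≠ w := by
      rintro rfl
      exact hnadj (hp u).1
    have huw : G.Adj u w := hs.isClique hu hw hne
    refine hsq u u.2 w w.2 ⟨huw, fun i j hi hj => ?_⟩
    obtain rfl : p u = i := le_antisymm ((hp u).le hi.1) (hi.le (hp u).1)
    obtain rfl : p w = j := le_antisymm ((hp w).le hj.1) (hj.le (hp w).1)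
    refine ⟨fun h => ?_, hnadj⟩
    have heq : p w = p u := le_antisymm ((hp w).le h) (hmax u hu)
    exact hnadj (heq ▸ (hp u).1)
  have hclique :
      G.IsClique (insert (b (p w)) (s.map (Function.Embedding.subtype _)) : Finset V) := by
    rw [Finset.coe_insert, isClique_insert]
    constructor
    · rintro _ hx _ hy hxy
      simp only [Finset.coe_map, Set.mem_image] at hx hy
      obtain ⟨x, hx, rfl⟩ := hx
      obtain ⟨y, hy, rfl⟩ := hy
      exact hs.isClique hx hy fun h => hxy (by rw [h])
    · intro x hx _
      simp only [Finset.coe_map, Set.mem_image] at hx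
      obtain ⟨x, hx, rfl⟩ := hx
      exact hadj x hx
  have hcard := hclique.card_le_cliqueNum
  rw [Finset.card_insert_of_notMem, Finset.card_map, hs.card_eq] at hcard
  · exact hcard
  · simp only [Finset.mem_map]
    rintro ⟨x, hx, hxb⟩
    have := hadj x hx
    rw [← hxb] at this
    exact this.ne rfl

/-- The graph of square edges. -/
def squareGraph (G : SimpleGraph V) {m : ℕ} (b : Fin m → V) : SimpleGraph V where
  Adj := SquareEdge G b
  symm := ⟨fun _ _ h => h.symm⟩
  loopless := ⟨fun _ h => h.1.ne rfl⟩

lemma squareGraph_le (G : SimpleGraph V) {m : ℕ} (b : Fin m → V) : squareGraph G b ≤ G :=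
  fun _ _ h => h.1

theorem stmt13 (φ : ℕ → ℕ) (hφ : Monotone φ) (ρ : ℕ) (hρ : 3 ≤ ρ) (τ c : ℕ)
    {V : Type*} [Fintype V] (G : SimpleGraph V) (hG : Controlled ρ φ G)
    (hτ1 : chiRho G (ρ - 1) ≤ (τ : ℕ∞))
    (hτ2 : ∀ Y : Set V, (G.induce Y).cliqueNum < G.cliqueNum →
      (G.induce Y).chromaticNumber ≤ (τ : ℕ∞))
    (m : ℕ) (b : Fin m → V) (hb : Function.Injective b) (C : Set V)
    (hcov : Covers G (Set.range b) C)
    (n : ℕ) (W : Fin n → Set V) (hgrad : IsGrading C W)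
    (hcompat : CompatibleEnum G b W C)
    (hcol : ∀ i, (G.induce (W i)).chromaticNumber ≤ (τ : ℕ∞))
    (hchiC : ((τ ^ 2 * (τ + 1 + φ (c + τ)) : ℕ) : ℕ∞) < (G.induce C).chromaticNumber) :
    ∃ u ∈ C, ∃ v ∈ C, SquareEdge G b u v ∧ ∃ X : Set V, IsBall G ρ X ∧
      (∀ w ∈ X, Earlier W u w ∧ Earlier W v w) ∧
      (∃ w ∈ X, G.Adj v w) ∧ (∀ w ∈ X, ¬ G.Adj u w) ∧
      (c : ℕ∞) < (G.induce X).chromaticNumber := by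
  classical
  have hball := colorable_ballWithin_of_chiRho_le hτ1
  by_contra hcon
  have hex : ∀ v ∈ C, ∃ i, v ∈ W i := fun v hv => by
    rw [← hgrad.1] at hv
    exact Set.mem_iUnion.1 hv
  obtain ⟨lev, hlev⟩ : ∃ lev : V → ℕ, ∀ v ∈ C, ∃ i : Fin n, lev v = i ∧ v ∈ W i := by
    refine ⟨fun v => if h : v ∈ C then (hex v h).choose else 0, fun v hv => ?_⟩
    exact ⟨(hex v hv).choose, by simp [hv], (hex v hv).choose_spec⟩
  have hearlier : ∀ u ∈ C, ∀ v ∈ C, lev u < lev v → Earlier W u v := by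
    intro u hu v hv huv
    obtain ⟨i, hi, hui⟩ := hlev u hu
    obtain ⟨j, hj, hvj⟩ := hlev v hv
    exact ⟨i, j, by rw [Fin.lt_def]; omega, hui, hvj⟩
  have hsquare : ∀ u ∈ C, ∀ v ∈ C, SquareEdge G b u v → ∀ X ⊆ C, IsBall G ρ X →
      (∀ w ∈ X, lev u < lev w ∧ lev v < lev w) → ¬ (G.induce X).Colorable c →
      (∃ w ∈ X, G.Adj v w) → ∃ w ∈ X, G.Adj u w := by
    intro u hu v hv huv X hXC hX hlt hXc hvX
    by_contra! huX
    refine hcon ⟨u, hu, v, hv, huv, X, hX, fun w hw => ?_, hvX, huX, ?_⟩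
    · exact ⟨hearlier u hu w (hXC hw) (hlt w hw).1, hearlier v hv w (hXC hw) (hlt w hw).2⟩
    · rwa [← not_le, chromaticNumber_le_iff_colorable]
  let Big : V → Set V → Prop := fun z X =>
    X ⊆ C ∧ z ∈ X ∧ X ⊆ ballWithin G X z ρ ∧ ¬ (G.induce X).Colorable (c + τ)
  let R : Set V := {v | v ∈ C ∧ ∃ z X, Big z X ∧ (∀ w ∈ X, lev v < lev w) ∧ ∃ w ∈ X, G.Adj v w}
  let M : Set V := {v | v ∈ C \ R ∧ ∃ z X, Big z X ∧ v ∈ X ∧ ∀ w ∈ X, lev v ≤ lev w}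
  let F : Set V := (C \ R) \ M
  have hR : ((squareGraph G b).induce R).Colorable τ := by
    refine colorable_induce_of_connected fun K hKR hconn => ?_
    refine colorable_induce_mono (squareGraph_le G b) subset_rfl le_rfl ?_
    rcases K.eq_empty_or_nonempty with rfl | hne
    · exact (induce_colorable_iff G ∅ τ).2 ⟨fun _ => 0, by simp, by simp⟩
    obtain ⟨v, hv, hmax⟩ := K.toFinite.exists_maximalFor lev K hne
    have hmax' : ∀ u ∈ K, lev u ≤ lev v := fun u hu => by
      by_contra h
      exact h (hmax hu (not_le.1 h).le)
    obtain ⟨-, z, X, ⟨hXC, hzX, hX, hXc⟩, hlt, hvX⟩ := hKR hv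
    have hK : ∀ X' ⊆ X, IsBall G ρ X' → ¬ (G.induce X').Colorable c →
        ∀ u ∈ K, ∀ v ∈ K, (∃ w ∈ X', G.Adj v w) → ∃ w ∈ X', G.Adj u w := by
      intro X' hX' hX'ball hX'c u hu v' hv' h
      refine hconn (fun u => ∃ w ∈ X', G.Adj u w) (fun x hx y hy hxy => ?_) v' hv' u hu h
      exact hsquare y (hKR hy).1 x (hKR hx).1 hxy.symm X' (hX'.trans hXC) hX'ball
        (fun w hw => ⟨(hmax' y hy).trans_lt (hlt w (hX' hw)),
          (hmax' x hx).trans_lt (hlt w (hX' hw))⟩) hX'c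
    have hXball : IsBall G ρ X := by
      rw [hX.antisymm (ballWithin_subset G X z ρ)]
      exact isBall_ballWithin G hzX ρ
    exact colorable_of_attached_ball hρ hball hzX hX hXc hK fun u hu =>
      hK X subset_rfl hXball
        (fun h => hXc (colorable_induce_mono le_rfl subset_rfl (by omega) h)) u hu v hv hvX
  have hMlev : ∀ x ∈ M, ∀ y ∈ M, G.Adj x y → lev y ≤ lev x := by
    rintro x ⟨⟨hxC, hxR⟩, -⟩ y ⟨-, z, X, hX, hyX, hle⟩ hxy
    by_contra! hlt
    exact hxR ⟨hxC, z, X, hX, fun w hw => hlt.trans_le (hle w hw), y, hyX, hxy⟩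
  have hM : (G.induce M).Colorable τ := by
    simp only [chromaticNumber_le_iff_colorable, induce_colorable_iff] at hcol
    choose f hf hfadj using hcol
    rw [induce_colorable_iff]
    refine ⟨fun x => if h : lev x < n then f ⟨lev x, h⟩ x else 0, ?_, ?_⟩
    · rintro x hx
      obtain ⟨i, hi, hxi⟩ := hlev x hx.1.1
      simpa [hi] using hf i x hxi
    · intro x hx y hy hxy
      have heq := le_antisymm (hMlev y hy x hx hxy.symm) (hMlev x hx y hy hxy)
      obtain ⟨i, hi, hxi⟩ := hlev x hx.1.1
      obtain ⟨j, hj, hyj⟩ := hlev y hy.1.1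
      obtain rfl : i = j := Fin.ext (by omega)
      simpa [hi, hj] using hfadj i x hxi y hyj hxy
  have hF : (G.induce F).Colorable (φ (c + τ)) := by
    refine hG.colorable_of_ballWithin hφ fun z hz => ?_
    by_contra hnc
    have hzX : z ∈ ballWithin G F z ρ := ballWithin_mono G F z (Nat.zero_le ρ) ⟨rfl, hz⟩
    have hXF := ballWithin_subset G F z ρ
    obtain ⟨v, hv, hmin⟩ := (ballWithin G F z ρ).toFinite.exists_minimalFor lev _ ⟨z, hzX⟩
    refine (hXF hv).2 ⟨(hXF hv).1, z, ballWithin G F z ρ,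
      ⟨fun x hx => (hXF hx).1.1, hzX, ballWithin_subset_self G F z le_rfl, hnc⟩, hv,
      fun w hw => ?_⟩
    by_contra h
    exact h (hmin hw (not_le.1 h).le)
  have hS : ((squareGraph G b).induce C).Colorable (τ + τ + φ (c + τ)) := by
    have hle := squareGraph_le G b
    refine colorable_induce_mono le_rfl (fun x hx => ?_) le_rfl
      (colorable_induce_union
        (colorable_induce_union hR (colorable_induce_mono hle subset_rfl le_rfl hM))
        (colorable_induce_mono hle subset_rfl le_rfl hF))
    by_cases hxR : x ∈ R
    · exact Or.inl (Or.inl hxR)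
    by_cases hxM : x ∈ M
    · exact Or.inl (Or.inr hxM)
    exact Or.inr ⟨⟨hx, hxR⟩, hxM⟩
  have hC : (G.induce C).Colorable ((τ + τ + φ (c + τ)) * τ) := by
    obtain ⟨f, hf, hfadj⟩ := (induce_colorable_iff _ _ _).1 hS
    refine colorable_induce_of_fibers f hf fun i => ?_
    rcases {x ∈ C | f x = i}.eq_empty_or_nonempty with h | hne
    · rw [h]
      exact (induce_colorable_iff G ∅ τ).2 ⟨fun _ => 0, by simp, by simp⟩
    rw [← chromaticNumber_le_iff_colorable]
    exact hτ2 _ (cliqueNum_induce_lt_of_no_squareEdge hcov (Set.sep_subset _ _) hne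
      fun u hu v hv huv => hfadj u hu.1 v hv.1 huv (hu.2.trans hv.2.symm))
  have hle : (τ + τ + φ (c + τ)) * τ ≤ τ ^ 2 * (τ + 1 + φ (c + τ)) := by
    rcases Nat.eq_zero_or_pos τ with rfl | hpos
    · simp
    · calc (τ + τ + φ (c + τ)) * τ ≤ (τ * (τ + 1 + φ (c + τ))) * τ := by
            refine Nat.mul_le_mul_right _ ?_
            nlinarith [Nat.zero_le (φ (c + τ))]
        _ = τ ^ 2 * (τ + 1 + φ (c + τ)) := by ring
  exact absurd (chromaticNumber_le_iff_colorable.2 (hC.mono hle)) (not_le.2 hchiC)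
end

section
/- Let φ : ℕ → ℕ be a nondecreasing function, and let ρ ≥ 3 and τ ≥ 0. For every integer c ≥ 1 there exists an integer c' ≥ 0 with the following property. Let G be a (ρ,φ)-controlled graph such that χ^{ρ−1}(G) ≤ τ and χ(J) ≤ τ for every induced subgraph J of G with ω(J) < ω(G). Let x ∈ V(G) be such that V(G) ∖ {x} is a ρ-ball, x has a neighbour in G ∖ x, and χ(V(G) ∖ {x}) > c'. Then there is a ρ-comet ({P, Q}, C) in G with tip x and chromatic number more than c, where |E(Q)| = |E(P)| + 1 and |E(P)| ≤ 2ρ + 1. -/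
open SimpleGraph

variable {V : Type*}

/-! ### Colourings of vertex subsets -/

/-- `G[S]` has a proper colouring with the colours `0, …, n - 1`. -/
def ColOn (G : SimpleGraph V) (S : Set V) (n : ℕ) : Prop :=
  ∃ f : V → ℕ, (∀ w ∈ S, f w < n) ∧ ∀ a ∈ S, ∀ b ∈ S, G.Adj a b → f a ≠ f b

theorem colOn_iff_colorable {G : SimpleGraph V} {S : Set V} {n : ℕ} :
    ColOn G S n ↔ (G.induce S).Colorable n := by
  classical
  constructor
  · rintro ⟨f, hf, hadj⟩
    refine ⟨Coloring.mk (fun w : S => (⟨f w, hf w w.2⟩ : Fin n)) ?_⟩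
    intro a b hab h
    exact hadj a a.2 b b.2 hab (Fin.mk.inj_iff.1 h)
  · rintro ⟨C⟩
    refine ⟨fun w => if h : w ∈ S then (C ⟨w, h⟩ : ℕ) else 0, ?_, ?_⟩
    · intro w hw
      simp [hw]
    · intro a ha b hb hab h
      simp only [ha, hb, dif_pos] at h
      exact C.valid (v := ⟨a, ha⟩) (w := ⟨b, hb⟩) hab (Fin.ext h)

theorem ColOn.mono {G : SimpleGraph V} {S T : Set V} {m n : ℕ} (h : ColOn G T m)
    (hST : S ⊆ T) (hmn : m ≤ n) : ColOn G S n := by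
  obtain ⟨f, hf, hadj⟩ := h
  exact ⟨f, fun w hw => (hf w (hST hw)).trans_le hmn,
    fun a ha b hb => hadj a (hST ha) b (hST hb)⟩

theorem ColOn.union {G : SimpleGraph V} {S T : Set V} {m n : ℕ} (hS : ColOn G S m)
    (hT : ColOn G T n) : ColOn G (S ∪ T) (m + n) := by
  classical
  obtain ⟨f, hf, hfa⟩ := hS
  obtain ⟨g, hg, hga⟩ := hT
  refine ⟨fun w => if w ∈ S then f w else m + g w, ?_, ?_⟩
  · rintro w hw
    by_cases h : w ∈ S
    · have := hf w h
      simp only [h, if_true]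
      omega
    · have := hg w (hw.resolve_left h)
      simp only [h, if_false]
      omega
  · intro a ha b hb hab
    by_cases h1 : a ∈ S <;> by_cases h2 : b ∈ S <;> simp only [h1, h2, if_true, if_false]
    · exact hfa a h1 b h2 hab
    · have := hf a h1
      omega
    · have := hf b h2
      omega
    · have := hga a (ha.resolve_left h1) b (hb.resolve_left h2) hab
      omega

theorem ColOn.biUnion {ι : Type*} {G : SimpleGraph V} {T : ι → Set V} {n : ℕ} (s : Finset ι)
    (h : ∀ i ∈ s, ColOn G (T i) n) : ColOn G (⋃ i ∈ s, T i) (s.card * n) := by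
  classical
  induction s using Finset.induction_on with
  | empty => exact ⟨fun _ => 0, by simp, by simp⟩
  | insert i s hi ih =>
    rw [Finset.set_biUnion_insert, Finset.card_insert_of_notMem hi, Nat.add_mul, one_mul,
      Nat.add_comm]
    exact (h i (Finset.mem_insert_self i s)).union
      (ih fun j hj => h j (Finset.mem_insert_of_mem hj))

/-! ### Walks inside vertex subsets, as sequences -/

/-- `p 0, …, p n` is a walk of `G` inside `S`. -/
def SeqIn (G : SimpleGraph V) (S : Set V) (p : ℕ → V) (n : ℕ) : Prop :=
  (∀ i ≤ n, p i ∈ S) ∧ ∀ i < n, G.Adj (p i) (p (i + 1))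

/-- The vertices that can be reached from `d` by a walk of length at most `n` inside `S`. -/
def BallIn (G : SimpleGraph V) (S : Set V) (d : V) (n : ℕ) : Set V :=
  {t | ∃ m ≤ n, ∃ p : ℕ → V, SeqIn G S p m ∧ p 0 = d ∧ p m = t}

theorem SeqIn.mono {G : SimpleGraph V} {S T : Set V} {p : ℕ → V} {m n : ℕ}
    (h : SeqIn G S p n) (hST : S ⊆ T) (hmn : m ≤ n) : SeqIn G T p m :=
  ⟨fun i hi => hST (h.1 i (hi.trans hmn)), fun i hi => h.2 i (hi.trans_le hmn)⟩

theorem SeqIn.drop {G : SimpleGraph V} {S : Set V} {p : ℕ → V} {n i : ℕ}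
    (h : SeqIn G S p n) (hi : i ≤ n) : SeqIn G S (fun j => p (i + j)) (n - i) :=
  ⟨fun j hj => h.1 _ (by omega), fun j hj => h.2 (i + j) (by omega)⟩

theorem SeqIn.reverse {G : SimpleGraph V} {S : Set V} {p : ℕ → V} {n : ℕ}
    (h : SeqIn G S p n) : SeqIn G S (fun j => p (n - j)) n := by
  refine ⟨fun j _ => h.1 _ (by omega), fun j hj => ?_⟩
  have := h.2 (n - (j + 1)) (by omega)
  rw [show n - (j + 1) + 1 = n - j by omega] at this
  exact this.symm

theorem SeqIn.cons {G : SimpleGraph V} {S : Set V} {p : ℕ → V} {n : ℕ} {a : V}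
    (h : SeqIn G S p n) (ha : a ∈ S) (hadj : G.Adj a (p 0)) :
    SeqIn G S (fun j => if j = 0 then a else p (j - 1)) (n + 1) := by
  constructor
  · intro i hi
    by_cases h0 : i = 0
    · simpa [h0] using ha
    · simpa [h0] using h.1 (i - 1) (by omega)
  · intro i hi
    by_cases h0 : i = 0
    · simpa [h0] using hadj
    · have := h.2 (i - 1) (by omega)
      rw [show i - 1 + 1 = i by omega] at this
      simpa [h0] using this

theorem BallIn.mono {G : SimpleGraph V} {S T : Set V} {d : V} {n : ℕ} (hST : S ⊆ T) :
    BallIn G S d n ⊆ BallIn G T d n := by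
  rintro t ⟨m, hm, p, hp, h⟩
  exact ⟨m, hm, p, hp.mono hST le_rfl, h⟩

theorem BallIn.subset {G : SimpleGraph V} {S : Set V} {d : V} {n : ℕ} :
    BallIn G S d n ⊆ S := by
  rintro t ⟨m, hm, p, hp, h0, rfl⟩
  exact hp.1 m le_rfl

theorem SeqIn.mem_ballIn {G : SimpleGraph V} {S : Set V} {p : ℕ → V} {n i ρ : ℕ}
    (h : SeqIn G S p n) (hn : n ≤ ρ) (hi : i ≤ n) : p i ∈ BallIn G S (p 0) ρ :=
  ⟨i, hi.trans hn, p, h.mono subset_rfl hi, rfl, rfl⟩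

theorem SeqIn.ballIn {G : SimpleGraph V} {S : Set V} {p : ℕ → V} {n ρ : ℕ}
    (h : SeqIn G S p n) (hn : n ≤ ρ) : SeqIn G (BallIn G S (p 0) ρ) p n :=
  ⟨fun _ hi => h.mem_ballIn hn hi, h.2⟩

theorem ballIn_ballIn {G : SimpleGraph V} {S : Set V} {d : V} {n : ℕ} :
    BallIn G S d n ⊆ BallIn G (BallIn G S d n) d n := by
  rintro t ⟨m, hm, p, hp, rfl, h⟩
  exact ⟨m, hm, p, hp.ballIn hm, rfl, h⟩

/-- A ball together with a short walk starting at its centre is a ball. -/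
theorem ballIn_union_seq {G : SimpleGraph V} {S T : Set V} {p : ℕ → V} {n ρ : ℕ}
    (h : SeqIn G T p n) (hn : n ≤ ρ) :
    ∀ t ∈ BallIn G S (p 0) ρ ∪ {t | ∃ i ≤ n, p i = t},
      t ∈ BallIn G (BallIn G S (p 0) ρ ∪ {t | ∃ i ≤ n, p i = t}) (p 0) ρ := by
  rintro t (ht | ⟨i, hi, rfl⟩)
  · exact BallIn.mono Set.subset_union_left (ballIn_ballIn ht)
  · have : SeqIn G (BallIn G S (p 0) ρ ∪ {t | ∃ i ≤ n, p i = t}) p n :=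
      ⟨fun j hj => Or.inr ⟨j, hj, rfl⟩, h.2⟩
    exact this.mem_ballIn hn hi

theorem SeqIn.exists_walk {G : SimpleGraph V} {S : Set V} {p : ℕ → V} {n : ℕ}
    (h : SeqIn G S p n) :
    ∃ w : (G.induce S).Walk ⟨p 0, h.1 0 n.zero_le⟩ ⟨p n, h.1 n le_rfl⟩, w.length = n := by
  induction n with
  | zero => exact ⟨Walk.nil, rfl⟩
  | succ n ih =>
    obtain ⟨w, hw⟩ := ih (h.mono subset_rfl n.le_succ)
    have hadj : (G.induce S).Adj ⟨p n, h.1 n n.le_succ⟩ ⟨p (n + 1), h.1 _ le_rfl⟩ :=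
      h.2 n n.lt_succ_self
    exact ⟨w.concat hadj, by rw [Walk.length_concat, hw]⟩

theorem isBall_of_ballIn {G : SimpleGraph V} {D : Set V} {d : V} {ρ : ℕ}
    (h : ∀ t ∈ D, t ∈ BallIn G D d ρ) : IsBall G ρ D := by
  rcases D.eq_empty_or_nonempty with h0 | ⟨t₀, ht₀⟩
  · exact Or.inl h0
  · right
    obtain ⟨_, _, p, hp, rfl, _⟩ := h t₀ ht₀
    refine ⟨⟨p 0, hp.1 0 (Nat.zero_le _)⟩, ?_⟩
    rintro ⟨u, hu⟩
    obtain ⟨m, hm, q, hq, h0, rfl⟩ := h u hu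
    obtain ⟨w, hw⟩ := hq.exists_walk
    rw [show (⟨p 0, hp.1 0 (Nat.zero_le _)⟩ : D) = ⟨q 0, hq.1 0 (Nat.zero_le _)⟩ from
      Subtype.ext h0.symm]
    exact ⟨w.reachable, (dist_le w).trans (hw.le.trans hm)⟩

theorem ballIn_of_dist_le {G : SimpleGraph V} {S : Set V} {z u : S} {ρ : ℕ}
    (h : (G.induce S).Reachable z u) (hd : (G.induce S).dist z u ≤ ρ) :
    (u : V) ∈ BallIn G S z ρ := by
  obtain ⟨w, hw⟩ := h.exists_walk_length_eq_dist
  refine ⟨w.length, hw.le.trans hd, fun i => w.getVert i, ⟨fun i _ => (w.getVert i).2, ?_⟩,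
    by simp, by simp⟩
  intro i hi
  exact w.adj_getVert_succ hi

theorem ballIn_univ_subset_closedNbhd {G : SimpleGraph V} {v : V} {n : ℕ} :
    BallIn G Set.univ v n ⊆ closedNbhd G v n := by
  rintro t ⟨m, hm, p, hp, rfl, rfl⟩
  obtain ⟨w, hw⟩ := hp.exists_walk
  let w' := w.map (Embedding.induce Set.univ).toHom
  have hw' : w'.length = m := (Walk.length_map _ _).trans hw
  exact ⟨w'.reachable, (dist_le w').trans (hw'.le.trans hm)⟩

theorem colOn_ballIn_univ {G : SimpleGraph V} {n τ : ℕ} (h : chiRho G n ≤ (τ : ℕ∞)) (v : V) :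
    ColOn G (BallIn G Set.univ v n) τ := by
  have h1 : (G.induce (closedNbhd G v n)).chromaticNumber ≤ (τ : ℕ∞) :=
    (le_iSup (fun v => (G.induce (closedNbhd G v n)).chromaticNumber) v).trans h
  exact (colOn_iff_colorable.2 (chromaticNumber_le_iff_colorable.1 h1)).mono
    ballIn_univ_subset_closedNbhd le_rfl

theorem Controlled.exists_ballIn {G : SimpleGraph V} {ρ : ℕ} {φ : ℕ → ℕ} (hφ : Monotone φ)
    (hG : Controlled ρ φ G) {S : Set V} {n : ℕ} (hS : ¬ ColOn G S (φ n)) :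
    ∃ d ∈ S, ¬ ColOn G (BallIn G S d ρ) n := by
  by_contra! hcon
  apply hS
  have h1 : chiRho (G.induce S) ρ ≤ (n : ℕ∞) := by
    refine iSup_le fun v => ?_
    rw [chromaticNumber_le_iff_colorable, ← colOn_iff_colorable]
    obtain ⟨f, hf, hadj⟩ := hcon v v.2
    exact ⟨fun w => f w, fun w hw => hf _ (ballIn_of_dist_le hw.1 hw.2),
      fun a ha b hb hab =>
        hadj a (ballIn_of_dist_le ha.1 ha.2) b (ballIn_of_dist_le hb.1 hb.2) hab⟩
  rw [colOn_iff_colorable, ← chromaticNumber_le_iff_colorable]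
  refine (hG S).trans ?_
  exact_mod_cast hφ (ENat.toNat_le_of_le_natCast h1)


/-! ### Ranked vertex sets -/

/-- A clique with at most `τ` vertices to which no vertex is complete. -/
def BigClique (G : SimpleGraph V) (τ : ℕ) (K : Finset V) : Prop :=
  G.IsClique (K : Set V) ∧ K.card ≤ τ ∧ ∀ p, ∃ b ∈ K, ¬ G.Adj p b

/-- The vertices of `Y` of rank more than `s`. -/
def Above (Y : Set V) (r : V → ℕ) (s : ℕ) : Set V :=
  {t | t ∈ Y ∧ s < r t}

/-- The vertices of `Z` which are of maximum rank in some big clique inside `Z`. -/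
def Tops (G : SimpleGraph V) (τ : ℕ) (r : V → ℕ) (Z : Set V) : Set V :=
  {w | ∃ K : Finset V, BigClique G τ K ∧ (K : Set V) ⊆ Z ∧ w ∈ K ∧ ∀ b ∈ K, r b ≤ r w}

/-- The result of applying `Tops` to `Y` repeatedly. -/
def IterTops (G : SimpleGraph V) (τ : ℕ) (r : V → ℕ) (Y : Set V) : ℕ → Set V
  | 0 => Y
  | i + 1 => Tops G τ r (IterTops G τ r Y i)

/-- There are a `ρ`-ball `D ⊆ Y` which is not `c`-colourable, and an edge `ab` of `G[Y]`, such that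
`r a < r b < r t` for all `t ∈ D`, and `b` has a neighbour in `D` while `a` has none. -/
def HasTail (G : SimpleGraph V) (Y : Set V) (r : V → ℕ) (ρ c : ℕ) : Prop :=
  ∃ (D : Set V) (d : V), ∃ b ∈ Y, ∃ a ∈ Y, (∀ t ∈ D, t ∈ BallIn G D d ρ) ∧ ¬ ColOn G D c ∧
    D ⊆ Above Y r (r b) ∧ G.Adj b a ∧ r a < r b ∧ (∃ t ∈ D, G.Adj b t) ∧ ∀ t ∈ D, ¬ G.Adj a t

theorem Above.mono {X Y : Set V} {r : V → ℕ} {s t : ℕ} (h : X ⊆ Y) (hst : t ≤ s) :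
    Above X r s ⊆ Above Y r t :=
  fun _ hw => ⟨h hw.1, hst.trans_lt hw.2⟩

theorem Tops.subset {G : SimpleGraph V} {τ : ℕ} {r : V → ℕ} {Z : Set V} : Tops G τ r Z ⊆ Z := by
  rintro w ⟨K, -, hKZ, hw, -⟩
  exact hKZ hw

theorem IterTops.antitone {G : SimpleGraph V} {τ : ℕ} {r : V → ℕ} {Y : Set V} :
    Antitone (IterTops G τ r Y) :=
  antitone_nat_of_succ_le fun _ => Tops.subset

theorem IterTops.subset {G : SimpleGraph V} {τ : ℕ} {r : V → ℕ} {Y : Set V} (i : ℕ) :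
    IterTops G τ r Y i ⊆ Y :=
  IterTops.antitone i.zero_le

/-- `τ` colours suffice for every vertex set without a big clique. -/
def CliqueForced (G : SimpleGraph V) (τ : ℕ) : Prop :=
  ∀ S : Set V, ¬ ColOn G S τ → ∃ K : Finset V, (K : Set V) ⊆ S ∧ BigClique G τ K

theorem CliqueForced.colOn_diff_tops {G : SimpleGraph V} {τ : ℕ} (h : CliqueForced G τ)
    (r : V → ℕ) (Z : Set V) [Nonempty V] : ColOn G (Z \ Tops G τ r Z) τ := by
  by_contra hcon
  obtain ⟨K, hKS, hK⟩ := h _ hcon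
  obtain ⟨b, hb, -⟩ := hK.2.2 (Classical.arbitrary V)
  obtain ⟨w, hw, hmax⟩ := K.exists_max_image r ⟨b, hb⟩
  exact (hKS hw).2 ⟨K, hK, hKS.trans Set.sdiff_subset, hw, hmax⟩

theorem CliqueForced.colOn_of_iterTops {G : SimpleGraph V} {τ : ℕ} (h : CliqueForced G τ)
    {r : V → ℕ} {Y : Set V} [Nonempty V] {n : ℕ} (i : ℕ) (hZ : ColOn G (IterTops G τ r Y i) n) :
    ColOn G Y (n + i * τ) := by
  induction i generalizing n with
  | zero => exact hZ.mono subset_rfl (by omega)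
  | succ i ih =>
    have h1 := hZ.union (h.colOn_diff_tops r (IterTops G τ r Y i))
    have h2 := ih (h1.mono (T := _) (S := IterTops G τ r Y i) ?_ le_rfl)
    · exact h2.mono subset_rfl (by ring_nf; omega)
    · intro w hw
      by_cases hw' : w ∈ Tops G τ r (IterTops G τ r Y i)
      · exact Or.inl hw'
      · exact Or.inr ⟨hw, hw'⟩

/-- A big clique whose top vertex attaches to a ball of larger rank through a vertex which is
the only one in the ball with neighbours in the clique. -/
theorem BigClique.hasTail {G : SimpleGraph V} {τ ρ c : ℕ} {r : V → ℕ} {Y : Set V}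
    (hr : ∀ a ∈ Y, ∀ b ∈ Y, G.Adj a b → r a ≠ r b) {K : Finset V} (hK : BigClique G τ K)
    (hKY : (K : Set V) ⊆ Y) {b : V} (hb : b ∈ K) (hmax : ∀ a ∈ K, r a ≤ r b) {D : Set V} {d : V}
    (hD : ∀ t ∈ D, t ∈ BallIn G D d ρ) (hDY : D ⊆ Above Y r (r b)) (hDc : ¬ ColOn G D c) {p : V}
    (hp : p ∈ D) (hpb : G.Adj p b) (hpu : ∀ a ∈ K, ∀ t ∈ D, G.Adj t a → t = p) :
    HasTail G Y r ρ c := by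
  obtain ⟨a, ha, hpa⟩ := hK.2.2 p
  have hab : b ≠ a := by
    rintro rfl
    exact hpa hpb
  have hadj : G.Adj b a := hK.1 hb ha hab
  refine ⟨D, d, b, hKY hb, a, hKY ha, hD, hDc, hDY, hadj,
    lt_of_le_of_ne (hmax a ha) (hr a (hKY ha) b (hKY hb) hadj.symm), ⟨p, hp, hpb.symm⟩, ?_⟩
  intro t ht hat
  obtain rfl := hpu a ha t ht hat.symm
  exact hpa hat.symm

/-- What is needed of a graph and a ranked vertex set for finding tails. -/
structure Setup (G : SimpleGraph V) (ρ τ : ℕ) (φ : ℕ → ℕ) (Y : Set V) (r : V → ℕ) : Prop where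
  mono : Monotone φ
  two_le : 2 ≤ ρ
  controlled : Controlled ρ φ G
  near (v : V) : ColOn G (BallIn G Set.univ v (ρ - 1)) τ
  forced : CliqueForced G τ
  rank_ne : ∀ a ∈ Y, ∀ b ∈ Y, G.Adj a b → r a ≠ r b

theorem SeqIn.mem_ballIn_of_adj {G : SimpleGraph V} {S T : Set V} {p : ℕ → V} {n i ρ : ℕ} {b : V}
    (h : SeqIn G S p n) (hi : i ≤ n) (hT : ∀ j, i ≤ j → j ≤ n → p j ∈ T) (hb : b ∈ T)
    (hadj : G.Adj b (p i)) (hρ : n - i + 1 ≤ ρ) : p n ∈ BallIn G T b ρ := by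
  have h1 : SeqIn G T (fun j => p (i + j)) (n - i) :=
    ⟨fun j hj => hT _ (by omega) (by omega), (h.drop hi).2⟩
  refine ⟨n - i + 1, hρ, _, h1.cons hb hadj, by simp, ?_⟩
  simp [show i + (n - i) = n by omega]

theorem Setup.colOn_ballIn_above {G : SimpleGraph V} {ρ τ c : ℕ} {φ : ℕ → ℕ} {Y : Set V}
    {r : V → ℕ} (h : Setup G ρ τ φ Y r) (hno : ¬ HasTail G Y r ρ c) {b : V} {s : ℕ}
    (hb : b ∈ Tops G τ r Y) (hs : r b ≤ s) :
    ColOn G (BallIn G ({b} ∪ Above Y r s) b ρ) (τ * τ + φ c) := by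
  classical
  have hρ := h.two_le
  obtain ⟨K, hK, hKY, hbK, hmax⟩ := hb
  set E := BallIn G ({b} ∪ Above Y r s) b ρ
  set U := ⋃ a ∈ K, BallIn G Set.univ a (ρ - 1)
  have hUc : ColOn G U (τ * τ) :=
    (ColOn.biUnion K fun a _ => h.near a).mono subset_rfl (Nat.mul_le_mul_right _ hK.2.1)
  suffices hS : ColOn G (E \ U) (φ c) by
    refine (hUc.union hS).mono ?_ le_rfl
    intro w hw
    by_cases hw' : w ∈ U
    · exact Or.inl hw'
    · exact Or.inr ⟨hw, hw'⟩
  by_contra hS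
  have hfar : ∀ {t}, t ∈ E \ U → ∀ a ∈ K, t ∉ BallIn G Set.univ a (ρ - 1) := by
    intro t ht a ha hta
    exact ht.2 (Set.mem_biUnion (by exact ha) hta)
  have hne : ∀ {t}, t ∈ E \ U → t ≠ b := by
    rintro t ht rfl
    exact hfar ht t hbK ⟨0, Nat.zero_le _, fun _ => t, ⟨by simp, by simp⟩, rfl, rfl⟩
  have habove : E \ U ⊆ Above Y r s := fun t ht =>
    (BallIn.subset ht.1).resolve_left (hne ht)
  obtain ⟨d, hd, hdc⟩ := h.controlled.exists_ballIn h.mono hS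
  obtain ⟨n, hn, q, hq, hq0, hqn⟩ := hd.1
  have hnρ : n = ρ := by
    by_contra hcon
    exact hfar hd b hbK ⟨n, by omega, q, hq.mono (Set.subset_univ _) le_rfl, hq0, hqn⟩
  subst hnρ
  have hnadj : ∀ a ∈ K, ∀ i, 2 ≤ i → i ≤ n → ¬ G.Adj a (q i) := by
    intro a ha i hi hin hadj
    apply hfar hd a ha
    rw [← hqn]
    exact hq.mem_ballIn_of_adj hin (fun _ _ _ => Set.mem_univ _) (Set.mem_univ _) hadj (by omega)
  have hqb : ∀ i, 1 ≤ i → i ≤ n → q i ≠ b := by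
    intro i hi hin hqi
    apply hfar hd b hbK
    rw [← hqn]
    exact ⟨n - i, by omega, fun j => q (i + j), (hq.drop hin).mono (Set.subset_univ _) le_rfl,
      hqi, by simp [show i + (n - i) = n by omega]⟩
  have hqY : ∀ i, 1 ≤ i → i ≤ n → q i ∈ Above Y r s := fun i hi hin =>
    (hq.1 i hin).resolve_left (hqb i hi hin)
  have hp : SeqIn G (Above Y r s) (fun j => q (n - j)) (n - 1) :=
    ⟨fun j hj => hqY _ (by omega) (by omega), (hq.reverse.mono subset_rfl (by omega)).2⟩
  have hball := ballIn_union_seq (S := E \ U) hp (ρ := n) (by omega)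
  have hd0 : q (n - 0) = d := hqn
  simp only [hd0] at hball
  have hq1 : q (n - (n - 1)) = q 1 := by rw [show n - (n - 1) = 1 by omega]
  apply hno
  refine hK.hasTail h.rank_ne hKY hbK hmax hball ?_
    (fun hcon => hdc (hcon.mono Set.subset_union_left le_rfl)) (p := q 1)
    (Or.inr ⟨n - 1, le_rfl, hq1⟩) ?_ ?_
  · rintro t (ht | ⟨i, hi, rfl⟩)
    · exact Above.mono subset_rfl hs (habove (BallIn.subset ht))
    · exact Above.mono subset_rfl hs (hqY _ (by omega) (by omega))
  · have := hq.2 0 (by omega)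
    rw [hq0] at this
    exact this.symm
  · rintro a ha t (ht | ⟨i, hi, rfl⟩) hta
    · exfalso
      apply hfar (BallIn.subset ht) a ha
      exact ⟨1, by omega, fun j => if j = 0 then a else t,
        ⟨by simp, by simpa using hta.symm⟩, by simp, by simp⟩
    · by_cases hi1 : i = n - 1
      · rw [hi1]
        exact hq1
      · exact absurd hta.symm (hnadj a ha _ (by omega) (by omega))

/-- If a walk with ranks above `s` leads from the centre of a ball to a vertex of rank at most `s`,
then the part of the ball with ranks above `s` can be coloured. -/
theorem Setup.colOn_of_seq {G : SimpleGraph V} {ρ τ c : ℕ} {φ : ℕ → ℕ} {Y : Set V}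
    {r : V → ℕ} (h : Setup G ρ τ φ Y r) (hno : ¬ HasTail G Y r ρ c) {s l : ℕ} {p : ℕ → V} {m : V}
    (hp : SeqIn G (Above (IterTops G τ r Y (ρ + 2)) r s) p l) (hl : l ≤ ρ)
    (hm : m ∈ IterTops G τ r Y (ρ + 2)) (hms : r m ≤ s) (hadj : G.Adj (p l) m) :
    ColOn G (BallIn G (Above (IterTops G τ r Y (ρ + 2)) r s) (p 0) ρ)
      (c + τ * (τ * τ + φ c)) := by
  classical
  set A := Above (IterTops G τ r Y (ρ + 2)) r s
  have hAY : A ⊆ Above Y r s := Above.mono (IterTops.subset _) le_rfl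
  have hex : ∃ j, ∃ m' ∈ IterTops G τ r Y (j + 2), r m' ≤ s ∧ G.Adj (p j) m' :=
    ⟨l, m, IterTops.antitone (show l + 2 ≤ ρ + 2 by omega) hm, hms, hadj⟩
  obtain ⟨m', hm', hms', hadj'⟩ := Nat.find_spec hex
  have hmin : ∀ j < Nat.find hex, ∀ b ∈ IterTops G τ r Y (j + 2), r b ≤ s → ¬ G.Adj (p j) b :=
    fun j hj b hb hbs hjb => Nat.find_min hex hj ⟨b, hb, hbs, hjb⟩
  have hfl : Nat.find hex ≤ l :=
    Nat.find_min' hex ⟨m, IterTops.antitone (show l + 2 ≤ ρ + 2 by omega) hm, hms, hadj⟩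
  generalize Nat.find hex = j at *
  have hpj : SeqIn G A p j := hp.mono subset_rfl hfl
  obtain ⟨K, hK, hKZ, hmK, hmax⟩ := hm'
  have hKs : ∀ b ∈ K, r b ≤ s := fun b hb => (hmax b hb).trans hms'
  have hKtop : ∀ b ∈ K, b ∈ Tops G τ r Y := fun b hb =>
    IterTops.antitone (show 1 ≤ j + 1 by omega) (hKZ hb)
  have hpK : ∀ i < j, ∀ b ∈ K, ¬ G.Adj (p i) b := fun i hi b hb =>
    hmin i hi b (IterTops.antitone (show i + 2 ≤ j + 1 by omega) (hKZ hb)) (hKs b hb)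
  set T := {p 0} ∪ {t | t ∈ A ∧ ∀ b ∈ K, ¬ G.Adj b t}
  have hTA : T ⊆ A := by
    rintro t (rfl | ht)
    · exact hp.1 0 (Nat.zero_le _)
    · exact ht.1
  have hC : ColOn G (BallIn G T (p 0) ρ) c := by
    by_contra hC
    apply hno
    refine hK.hasTail h.rank_ne (hKZ.trans (IterTops.subset _)) hmK hmax
      (ballIn_union_seq (S := T) hpj (hfl.trans hl)) ?_
      (fun hcon => hC (hcon.mono Set.subset_union_left le_rfl)) (p := p j)
      (Or.inr ⟨j, le_rfl, rfl⟩) hadj' ?_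
    · rintro t (ht | ⟨i, hi, rfl⟩)
      · exact Above.mono subset_rfl hms' (hAY (hTA (BallIn.subset ht)))
      · exact Above.mono subset_rfl hms' (hAY (hpj.1 i hi))
    · have hi : ∀ a ∈ K, ∀ i ≤ j, G.Adj (p i) a → p i = p j := by
        intro a ha i hij hia
        rcases hij.lt_or_eq with h1 | rfl
        · exact absurd hia (hpK i h1 a ha)
        · rfl
      rintro a ha t (ht | ⟨i, hij, rfl⟩) hta
      · rcases BallIn.subset ht with ht | ht
        · rw [Set.mem_singleton_iff] at ht
          rw [ht] at hta ⊢
          exact hi a ha 0 (Nat.zero_le _) hta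
        · exact absurd hta.symm (ht.2 a ha)
      · exact hi a ha i hij hta
  have hU : ColOn G (⋃ b ∈ K, BallIn G ({b} ∪ Above Y r s) b ρ) (τ * (τ * τ + φ c)) :=
    (ColOn.biUnion K fun b hb => h.colOn_ballIn_above hno (hKtop b hb) (hKs b hb)).mono
      subset_rfl (Nat.mul_le_mul_right _ hK.2.1)
  refine (hC.union hU).mono ?_ le_rfl
  rintro t ⟨n, hn, q, hq, hq0, rfl⟩
  by_cases hcase : ∃ i, 1 ≤ i ∧ i ≤ n ∧ ∃ b ∈ K, G.Adj b (q i)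
  · obtain ⟨i, hi1, hin, b, hb, hbi⟩ := hcase
    exact Or.inr (Set.mem_biUnion (by exact hb) (hq.mem_ballIn_of_adj hin
      (fun k _ hk => Or.inr (hAY (hq.1 k hk))) (Or.inl rfl) hbi (by omega)))
  · push Not at hcase
    refine Or.inl ⟨n, hn, q, ⟨fun i hi => ?_, hq.2⟩, hq0, rfl⟩
    rcases Nat.eq_zero_or_pos i with rfl | hi0
    · exact Or.inl hq0
    · exact Or.inr ⟨hq.1 i hi, hcase i hi0 hi⟩

/-- The number of colours needed for the balls of `Setup.colOn_ballIn`. -/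
def tailBound (φ : ℕ → ℕ) (τ c : ℕ) : ℕ :=
  (c + τ * (τ * τ + φ c)) + τ + (τ * τ + φ c) + φ (c + τ * (τ * τ + φ c))

theorem Setup.colOn_ballIn {G : SimpleGraph V} {ρ τ c : ℕ} {φ : ℕ → ℕ} {Y : Set V}
    {r : V → ℕ} (h : Setup G ρ τ φ Y r) (hno : ¬ HasTail G Y r ρ c) (u : V → V)
    (hu : ∀ w ∈ Y, G.Adj w (u w)) (hru : ∀ a ∈ Y, ∀ b ∈ Y, r a = r b → u a = u b) {d : V}
    (hd : d ∈ IterTops G τ r Y (ρ + 2)) :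
    ColOn G (BallIn G (IterTops G τ r Y (ρ + 2)) d ρ) (tailBound φ τ c) := by
  classical
  have hρ := h.two_le
  set X := IterTops G τ r Y (ρ + 2)
  have hXY : X ⊆ Y := IterTops.subset _
  set E := BallIn G X d ρ
  have hdE : d ∈ E := ⟨0, Nat.zero_le _, fun _ => d, ⟨by simpa using hd, by simp⟩, rfl, rfl⟩
  obtain ⟨m, hmE, hmin⟩ : ∃ m ∈ E, ∀ t ∈ E, r m ≤ r t := by
    have hex : ∃ s, ∃ t ∈ E, r t = s := ⟨_, d, hdE, rfl⟩
    obtain ⟨m, hm, hrm⟩ := Nat.find_spec hex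
    exact ⟨m, hm, fun t ht => hrm.trans_le (Nat.find_min' hex ⟨t, ht, rfl⟩)⟩
  set s := r m
  have hmX : m ∈ X := BallIn.subset hmE
  have hclass : ∀ w ∈ X, r w = s → G.Adj w (u m) := by
    intro w hw hws
    rw [← hru w (hXY hw) m (hXY hmX) hws]
    exact hu w (hXY hw)
  have h1 : ColOn G (BallIn G (Above X r s) d ρ) (c + τ * (τ * τ + φ c)) := by
    by_cases hds : s < r d
    · obtain ⟨n, hn, q, hq, hq0, hqn⟩ := hmE
      have hex : ∃ i, r (q i) ≤ s := ⟨n, by rw [hqn]⟩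
      have hi := Nat.find_spec hex
      have hin : Nat.find hex ≤ n := Nat.find_min' hex (by rw [hqn])
      have hlt : ∀ j < Nat.find hex, s < r (q j) := fun j hj => not_le.1 (Nat.find_min hex hj)
      generalize Nat.find hex = i at *
      have hi0 : i ≠ 0 := by
        rintro rfl
        rw [hq0] at hi
        omega
      rw [← hq0]
      have hadj := hq.2 (i - 1) (by omega)
      rw [show i - 1 + 1 = i by omega] at hadj
      exact h.colOn_of_seq hno (p := q) (l := i - 1) (m := q i)
        ⟨fun j hj => ⟨hq.1 j (by omega), hlt j (by omega)⟩, fun j hj => hq.2 j (by omega)⟩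
        (by omega) (hq.1 i hin) hi hadj
    · refine ⟨fun _ => 0, ?_, ?_⟩
      · rintro w ⟨n, hn, q, hq, hq0, hqn⟩
        exact absurd (hq0 ▸ (hq.1 0 (Nat.zero_le _)).2) hds
      · rintro w ⟨n, hn, q, hq, hq0, hqn⟩
        exact absurd (hq0 ▸ (hq.1 0 (Nat.zero_le _)).2) hds
  have h2 : ColOn G (BallIn G Set.univ (u m) (ρ - 1)) τ := h.near _
  have h3 : ColOn G {t | t ∈ BallIn G ({d} ∪ Above Y r s) d ρ ∧ r d = s} (τ * τ + φ c) := by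
    by_cases hds : r d = s
    · have hdt : d ∈ Tops G τ r Y := IterTops.antitone (show 1 ≤ ρ + 2 by omega) hd
      exact (h.colOn_ballIn_above hno hdt hds.le).mono (fun t ht => ht.1) le_rfl
    · exact ⟨fun _ => 0, fun w hw => absurd hw.2 hds, fun w hw => absurd hw.2 hds⟩
  set F := {t | ∃ n ≤ ρ, ∃ q : ℕ → V, SeqIn G (Above X r s) (fun j => q (j + 2)) (n - 2) ∧
    2 ≤ n ∧ q 1 ∈ X ∧ r (q 1) = s ∧ G.Adj (q 1) (q 2) ∧ q n = t}
  set F' := F \ BallIn G Set.univ (u m) (ρ - 1)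
  have hFA : F ⊆ Above X r s := by
    rintro t ⟨n, hn, q, hq, hn2, -, -, -, rfl⟩
    have := hq.1 (n - 2) le_rfl
    simpa [show n - 2 + 2 = n by omega] using this
  have h4 : ColOn G F' (φ (c + τ * (τ * τ + φ c))) := by
    by_contra hcon
    obtain ⟨d', hd', hdc⟩ := h.controlled.exists_ballIn h.mono hcon
    apply hdc
    obtain ⟨n, hn, q, hq, hn2, hq1X, hq1s, hq12, hqn⟩ := hd'.1
    have hrev := hq.reverse
    have hc := h.colOn_of_seq hno hrev (m := q 1) (by omega) hq1X hq1s.le (by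
      simpa using hq12.symm)
    have h0 : q (n - 2 - 0 + 2) = d' := by rw [show n - 2 - 0 + 2 = n by omega, hqn]
    rw [h0] at hc
    exact hc.mono (BallIn.mono fun t ht => hFA ht.1) le_rfl
  refine (((h1.union h2).union h3).union h4).mono ?_ le_rfl
  rintro t ⟨n, hn, q, hq, hq0, rfl⟩
  have hqs : ∀ i ≤ n, s ≤ r (q i) := fun i hi =>
    hmin _ ⟨i, hi.trans hn, q, hq.mono subset_rfl hi, hq0, rfl⟩
  by_cases hnear : q n ∈ BallIn G Set.univ (u m) (ρ - 1)
  · exact Or.inl (Or.inl (Or.inr hnear))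
  have hlate : ∀ i, i ≤ n → n - i + 1 ≤ ρ - 1 → s < r (q i) := by
    intro i hi hni
    refine lt_of_le_of_ne (hqs i hi) fun hsi => hnear ?_
    exact hq.mem_ballIn_of_adj hi (fun _ _ _ => Set.mem_univ _) (Set.mem_univ _)
      (hclass _ (hq.1 i hi) hsi.symm).symm hni
  by_cases h0 : r (q 0) = s
  · refine Or.inl (Or.inr ⟨⟨n, hn, q, ⟨fun i hi => ?_, hq.2⟩, hq0, rfl⟩, hq0 ▸ h0⟩)
    rcases Nat.eq_zero_or_pos i with rfl | hi0
    · exact Or.inl hq0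
    · refine Or.inr ⟨hXY (hq.1 i hi), ?_⟩
      rcases Nat.lt_or_ge i 2 with hi2 | hi2
      · obtain rfl : i = 1 := by omega
        refine lt_of_le_of_ne (hqs 1 hi) fun h1' => ?_
        exact h.rank_ne _ (hXY (hq.1 0 (by omega))) _ (hXY (hq.1 1 hi)) (hq.2 0 (by omega))
          (h0.trans h1')
      · exact hlate i hi (by omega)
  have h0' : s < r (q 0) := lt_of_le_of_ne (hqs 0 (Nat.zero_le _)) (Ne.symm h0)
  by_cases hq1 : 1 ≤ n ∧ r (q 1) = s
  · have hn2 : 2 ≤ n := by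
      by_contra hcon
      have := hlate 1 hq1.1 (by omega)
      omega
    refine Or.inr ⟨⟨n, hn, q, ⟨fun j hj => ⟨hq.1 _ (by omega), hlate _ (by omega) (by omega)⟩,
      fun j hj => hq.2 (j + 2) (by omega)⟩, hn2, hq.1 1 hq1.1, hq1.2, hq.2 1 (by omega), rfl⟩,
      hnear⟩
  · refine Or.inl (Or.inl (Or.inl ⟨n, hn, q, ⟨fun i hi => ⟨hq.1 i hi, ?_⟩, hq.2⟩, hq0, rfl⟩))
    rcases Nat.lt_or_ge i 2 with hi2 | hi2
    · interval_cases i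
      · exact h0'
      · exact lt_of_le_of_ne (hqs 1 hi) fun h1' => hq1 ⟨hi, h1'.symm⟩
    · exact hlate i hi (by omega)

theorem Setup.hasTail {G : SimpleGraph V} {ρ τ c : ℕ} {φ : ℕ → ℕ} {Y : Set V}
    {r : V → ℕ} (h : Setup G ρ τ φ Y r) (u : V → V)
    (hu : ∀ w ∈ Y, G.Adj w (u w)) (hru : ∀ a ∈ Y, ∀ b ∈ Y, r a = r b → u a = u b)
    (hY : ¬ ColOn G Y (φ (tailBound φ τ c) + (ρ + 2) * τ)) : HasTail G Y r ρ c := by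
  by_contra hno
  have : Nonempty V := by
    by_contra hemp
    rw [not_nonempty_iff] at hemp
    exact hY ⟨fun _ => 0, fun w => hemp.elim w, fun w => hemp.elim w⟩
  have hX : ¬ ColOn G (IterTops G τ r Y (ρ + 2)) (φ (tailBound φ τ c)) := fun hX =>
    hY (h.forced.colOn_of_iterTops (ρ + 2) hX)
  obtain ⟨d, hd, hdc⟩ := h.controlled.exists_ballIn h.mono hX
  exact hdc (h.colOn_ballIn hno u hu hru hd)

/-! ### Big cliques, geodesics and induced paths -/

theorem cliqueForced_of_cliqueNum [Fintype V] {G : SimpleGraph V} {n τ : ℕ} (hn : 1 ≤ n)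
    (hnear : ∀ v, ColOn G (BallIn G Set.univ v n) τ)
    (h : ∀ Y : Set V, (G.induce Y).cliqueNum < G.cliqueNum →
      (G.induce Y).chromaticNumber ≤ (τ : ℕ∞)) : CliqueForced G τ := by
  classical
  intro S hS
  have hle : G.cliqueNum ≤ (G.induce S).cliqueNum := by
    by_contra hcon
    exact hS (colOn_iff_colorable.2 (chromaticNumber_le_iff_colorable.1 (h S (not_le.1 hcon))))
  obtain ⟨t, ht⟩ := (G.induce S).exists_isNClique_cliqueNum
  rw [isNClique_induce_iff] at ht
  refine ⟨t.map (Function.Embedding.subtype (· ∈ S)), ?_, ht.isClique, ?_, ?_⟩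
  · intro w hw
    simp only [Finset.coe_map, Set.mem_image] at hw
    obtain ⟨w, -, rfl⟩ := hw
    exact w.2
  · generalize t.map (Function.Embedding.subtype (· ∈ S)) = K at ht
    rcases K.eq_empty_or_nonempty with rfl | ⟨b, hb⟩
    · exact Nat.zero_le _
    · obtain ⟨f, hf, hadj⟩ := hnear b
      have hmem : ∀ a ∈ K, a ∈ BallIn G Set.univ b n := by
        intro a ha
        by_cases hab : a = b
        · exact ⟨0, Nat.zero_le _, fun _ => a, ⟨by simp, by simp⟩, hab, rfl⟩
        · refine ⟨1, hn, fun j => if j = 0 then b else a, ⟨by simp, ?_⟩, by simp, by simp⟩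
          simpa using ht.isClique hb ha (Ne.symm hab)
      have := Finset.card_le_card_of_injOn (s := K) (t := Finset.range τ) f
        (fun a ha => Finset.mem_coe.2 (Finset.mem_range.2 (hf a (hmem a ha)))) (by
          intro a ha a' ha' haa
          by_contra hne
          exact hadj a (hmem a ha) a' (hmem a' ha') (ht.isClique ha ha' hne) haa)
      simpa using this
  · intro p
    by_contra! hp
    have hpK : p ∉ t.map (Function.Embedding.subtype (· ∈ S)) := fun hcon =>
      G.loopless.irrefl p (hp p hcon)
    have hcl : G.IsClique ((insert p (t.map (Function.Embedding.subtype (· ∈ S))) : Finset V) :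
        Set V) := by
      rw [Finset.coe_insert]
      exact ht.isClique.insert fun b hb _ => hp b hb
    have := hcl.card_le_cliqueNum
    rw [Finset.card_insert_of_notMem hpK, ht.card_eq] at this
    omega

theorem exists_parent {G : SimpleGraph V} {x w : V} (h : G.Reachable x w) (hw : w ≠ x) :
    ∃ v, G.Adj w v ∧ G.dist x v + 1 = G.dist x w := by
  obtain ⟨p, hp⟩ := h.exists_walk_length_eq_dist
  have h0 : p.length ≠ 0 := fun hcon => hw (Walk.eq_of_length_eq_zero hcon).symm
  have hadj := p.adj_getVert_succ (show p.length - 1 < p.length by omega)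
  rw [show p.length - 1 + 1 = p.length by omega, Walk.getVert_length] at hadj
  refine ⟨p.getVert (p.length - 1), hadj.symm, ?_⟩
  have h1 := (dist_le (p.take (p.length - 1))).trans_eq (p.take_length (p.length - 1))
  rcases hadj.diff_dist_adj (u := x) with h2 | h2 | h2 <;> omega

theorem exists_pathGraph_embedding {G : SimpleGraph V} {n : ℕ} (p : ℕ → V)
    (h : ∀ i j, i < j → j ≤ n → p i ≠ p j ∧ (G.Adj (p i) (p j) ↔ i + 1 = j)) :
    ∃ f : pathGraph (n + 1) ↪g G, ∀ i, f i = p i := by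
  have hinj : Function.Injective fun i : Fin (n + 1) => p i := by
    intro i j hij
    rcases lt_trichotomy i j with h1 | h1 | h1
    · exact absurd hij (h i j h1 (by omega)).1
    · exact h1
    · exact absurd hij.symm (h j i h1 (by omega)).1
  refine ⟨⟨⟨_, hinj⟩, ?_⟩, fun i => rfl⟩
  intro i j
  rw [pathGraph_adj]
  change G.Adj (p i) (p j) ↔ _
  rcases lt_trichotomy i j with h1 | rfl | h1
  · rw [(h i j h1 (by omega)).2]
    have : (i : ℕ) < j := h1
    omega
  · simp
  · rw [adj_comm, (h j i h1 (by omega)).2]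
    have : (j : ℕ) < i := h1
    omega

/-- `u` maps every vertex other than `x` to a neighbour that is closer to `x`. -/
def IsParentMap (G : SimpleGraph V) (x : V) (u : V → V) : Prop :=
  ∀ w, w ≠ x → G.Adj w (u w) ∧ G.dist x (u w) + 1 = G.dist x w

namespace IsParentMap

variable {G : SimpleGraph V} {x : V} {u : V → V}

theorem dist_iterate (hu : IsParentMap G x u) (w : V) :
    ∀ j ≤ G.dist x w, G.dist x (u^[j] w) + j = G.dist x w := by
  intro j
  induction j with
  | zero => intro _; simp
  | succ j ih =>
    intro hj
    have h1 := ih (by omega)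
    have hne : u^[j] w ≠ x := by
      intro hcon
      rw [hcon, dist_self] at h1
      omega
    have := (hu _ hne).2
    rw [Function.iterate_succ_apply']
    omega

theorem adj_iterate (hu : IsParentMap G x u) (w : V) {j : ℕ} (hj : j < G.dist x w) :
    G.Adj (u^[j + 1] w) (u^[j] w) := by
  rw [Function.iterate_succ_apply']
  refine (hu _ ?_).1.symm
  intro hcon
  have := hu.dist_iterate w j hj.le
  rw [hcon, dist_self] at this
  omega

theorem iterate_dist (hu : IsParentMap G x u) (hx : ∀ w, G.Reachable x w) (w : V) :
    u^[G.dist x w] w = x := by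
  have := hu.dist_iterate w _ le_rfl
  exact ((hx _).dist_eq_zero_iff.1 (by omega)).symm

theorem not_adj_of_dist {a b : V} (h : G.dist x a + 1 < G.dist x b) : ¬ G.Adj a b := by
  intro hadj
  rcases hadj.diff_dist_adj (u := x) with h1 | h1 | h1 <;> omega

theorem iterate_induced (hu : IsParentMap G x u) (w : V) {i j : ℕ} (hij : i < j)
    (hj : j ≤ G.dist x w) :
    u^[G.dist x w - i] w ≠ u^[G.dist x w - j] w ∧
      (G.Adj (u^[G.dist x w - i] w) (u^[G.dist x w - j] w) ↔ i + 1 = j) := by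
  have h1 := hu.dist_iterate w (G.dist x w - i) (by omega)
  have h2 := hu.dist_iterate w (G.dist x w - j) (by omega)
  refine ⟨fun hcon => ?_, fun hadj => ?_, fun h => ?_⟩
  · rw [hcon] at h1
    omega
  · by_contra hne
    exact not_adj_of_dist (x := x) (by omega) hadj
  · have := hu.adj_iterate w (show G.dist x w - j < G.dist x w by omega)
    rwa [show G.dist x w - j + 1 = G.dist x w - i by omega] at this

theorem exists_path (hu : IsParentMap G x u) (w : V) :
    ∃ P : pathGraph (G.dist x w + 1) ↪g G, ∀ i, P i = u^[G.dist x w - i] w :=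
  exists_pathGraph_embedding (fun i => u^[G.dist x w - i] w)
    fun _ _ hij hj => hu.iterate_induced w hij hj

theorem exists_path_append (hu : IsParentMap G x u) {a b : V} (hab : G.Adj a b)
    (hd : G.dist x a = G.dist x b) (hub : ¬ G.Adj (u a) b) :
    ∃ Q : pathGraph (G.dist x b + 2) ↪g G,
      ∀ i, Q i = if (i : ℕ) ≤ G.dist x b then u^[G.dist x b - i] a else b := by
  rw [← hd]
  refine exists_pathGraph_embedding
    (fun i => if i ≤ G.dist x a then u^[G.dist x a - i] a else b) fun i j hij hj => ?_
  have hi : i ≤ G.dist x a := by omega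
  by_cases hj' : j ≤ G.dist x a
  · simpa [hi, hj'] using hu.iterate_induced a hij hj'
  · obtain rfl : j = G.dist x a + 1 := by omega
    simp only [hi, hj', if_true, if_false]
    have h1 := hu.dist_iterate a (G.dist x a - i) (by omega)
    obtain h2 | h2 | h2 : i = G.dist x a ∨ i + 1 = G.dist x a ∨ i + 2 ≤ G.dist x a := by omega
    · simp [h2, hab, hab.ne]
    · have h3 : G.dist x a - i = 1 := by omega
      rw [h3] at h1 ⊢
      refine ⟨fun hcon => ?_, fun hadj => absurd hadj hub, fun h => by omega⟩
      rw [hcon] at h1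
      omega
    · refine ⟨fun hcon => ?_, fun hadj => ?_, fun h => by omega⟩
      · rw [hcon] at h1
        omega
      · exact absurd hadj (not_adj_of_dist (x := x) (by omega))

end IsParentMap

theorem IsBall.reachable_and_dist_le {G : SimpleGraph V} {ρ : ℕ} {x w : V}
    (h : IsBall G ρ ({x}ᶜ : Set V)) (hw : w ≠ x) (hadj : G.Adj x w) (v : V) :
    G.Reachable x v ∧ G.dist x v ≤ 2 * ρ + 1 := by
  by_cases hv : v = x
  · subst hv
    exact ⟨Reachable.refl _, by simp⟩
  rcases h with h | ⟨z, hz⟩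
  · exact absurd (show w ∈ ({x}ᶜ : Set V) from hw) (h ▸ Set.notMem_empty w)
  · have key : ∀ t, t ≠ x → G.Reachable z t ∧ G.dist z t ≤ ρ := fun t ht =>
      ballIn_univ_subset_closedNbhd (BallIn.mono (Set.subset_univ _)
        (ballIn_of_dist_le (u := ⟨t, ht⟩) (hz ⟨t, ht⟩).1 (hz ⟨t, ht⟩).2))
    have h1 := key w hw
    have h2 := key v hv
    have h3 : G.dist x w = 1 := dist_eq_one_iff_adj.2 hadj
    have h4 := hadj.reachable.dist_triangle_left v
    have h5 := h1.1.symm.dist_triangle_left v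
    rw [dist_comm (u := w) (v := (z : V))] at h5
    exact ⟨hadj.reachable.trans (h1.1.symm.trans h2.1), by omega⟩

theorem stmt14 (φ : ℕ → ℕ) (hφ : Monotone φ) (ρ τ : ℕ) (hρ : 3 ≤ ρ) (c : ℕ) (hc : 1 ≤ c) :
    ∃ c' : ℕ, ∀ (V : Type) [Fintype V] (G : SimpleGraph V) (x : V),
      Controlled ρ φ G →
      chiRho G (ρ - 1) ≤ (τ : ℕ∞) →
      (∀ Y : Set V, (G.induce Y).cliqueNum < G.cliqueNum →
        (G.induce Y).chromaticNumber ≤ (τ : ℕ∞)) →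
      IsBall G ρ ({x}ᶜ : Set V) →
      (∃ w, w ≠ x ∧ G.Adj x w) →
      (c' : ℕ∞) < (G.induce ({x}ᶜ : Set V)).chromaticNumber →
      ∃ (k : ℕ) (P : pathGraph (k + 1) ↪g G) (Q : pathGraph (k + 2) ↪g G) (y : V)
        (C : Set V),
        IsBall G ρ C ∧
        P 0 = x ∧ Q 0 = x ∧ P (Fin.last k) = y ∧ Q (Fin.last (k + 1)) = y ∧
        (∃ w ∈ C, G.Adj y w) ∧
        (∀ u, (u ∈ Set.range P ∨ u ∈ Set.range Q) → u ≠ y → ∀ w ∈ C, ¬ G.Adj u w) ∧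
        (c : ℕ∞) < (G.induce C).chromaticNumber ∧
        k ≤ 2 * ρ + 1 := by
  classical
  refine ⟨(Finset.range (2 * ρ + 2) ×ˢ Finset.range τ).card *
    (φ (tailBound φ τ c) + (ρ + 2) * τ), ?_⟩
  intro V _ G x hG hτ hω hball hx hχ
  obtain ⟨w₀, hw₀, hxw₀⟩ := hx
  have hreach := hball.reachable_and_dist_le hw₀ hxw₀
  have hnear := colOn_ballIn_univ hτ
  have hforced := cliqueForced_of_cliqueNum (n := ρ - 1) (by omega) hnear hω
  choose f hf hfadj using hnear
  let e : V → ℕ := fun w => Fintype.equivFin V w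
  have he : Function.Injective e := fun a b hab => (Fintype.equivFin V).injective (Fin.ext hab)
  have hpar : ∀ w, w ≠ x → ∃ v, (G.Adj w v ∧ G.dist x v + 1 = G.dist x w) ∧
      ∀ v', G.Adj w v' → G.dist x v' + 1 = G.dist x w → e v ≤ e v' := by
    intro w hw
    obtain ⟨v₀, hv₀⟩ := exists_parent (hreach w).1 hw
    obtain ⟨v, hv, hmin⟩ := Finset.exists_min_image
      (Finset.univ.filter fun v => G.Adj w v ∧ G.dist x v + 1 = G.dist x w) e
      ⟨v₀, by simpa using hv₀⟩
    exact ⟨v, by simpa using hv, fun v' h1 h2 => hmin v' (by simp [h1, h2])⟩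
  choose! u hu hmin using hpar
  have hmem : ∀ w, w ≠ x → w ∈ BallIn G Set.univ (u w) (ρ - 1) := fun w hw =>
    ⟨1, by omega, fun j => if j = 0 then u w else w,
      ⟨by simp, by simpa using (hu w hw).1.symm⟩, by simp, by simp⟩
  let Y : ℕ × ℕ → Set V := fun i => {w | w ≠ x ∧ G.dist x w = i.1 ∧ f (u w) w = i.2}
  obtain ⟨i, hi⟩ : ∃ i, ¬ ColOn G (Y i) (φ (tailBound φ τ c) + (ρ + 2) * τ) := by
    by_contra! hcon
    refine hχ.not_ge ?_
    rw [chromaticNumber_le_iff_colorable, ← colOn_iff_colorable]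
    refine (ColOn.biUnion (Finset.range (2 * ρ + 2) ×ˢ Finset.range τ)
      fun i _ => hcon i).mono ?_ le_rfl
    intro w hw
    refine Set.mem_biUnion (x := (G.dist x w, f (u w) w)) ?_ ⟨hw, rfl, rfl⟩
    have := (hreach w).2
    exact Finset.mem_coe.2 (Finset.mk_mem_product (Finset.mem_range.2 (by omega))
      (Finset.mem_range.2 (hf _ _ (hmem w hw))))
  have hset : Setup G ρ τ φ (Y i) (fun w => e (u w)) := by
    refine ⟨hφ, by omega, hG, colOn_ballIn_univ hτ, hforced, ?_⟩
    intro a ha b hb hab heq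
    have huab : u a = u b := he heq
    exact hfadj (u a) a (hmem a ha.1) b (huab ▸ hmem b hb.1) hab
      (ha.2.2.trans (huab ▸ hb.2.2.symm))
  obtain ⟨D, d, b, hb, a, ha, hD, hDc, hDY, hba, hlt, hbD, haD⟩ :=
    hset.hasTail u (fun w hw => (hu w hw.1).1) (fun a _ b _ h => he h) hi
  have huP : IsParentMap G x u := hu
  have hdab : G.dist x a = G.dist x b := ha.2.1.trans hb.2.1.symm
  have hDdist : ∀ t ∈ D, t ≠ x ∧ G.dist x t = G.dist x b := fun t ht =>
    ⟨(hDY ht).1.1, (hDY ht).1.2.1.trans hb.2.1.symm⟩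
  have hparD : ∀ w, w ≠ x → G.dist x w = G.dist x b → e (u w) ≤ e (u b) →
      ∀ t ∈ D, ¬ G.Adj (u w) t := by
    intro w hw hwd hle t ht hadj
    have h1 := hmin t (hDdist t ht).1 (u w) hadj.symm (by
      rw [(hu w hw).2, hwd, (hDdist t ht).2])
    have h2 : e (u b) < e (u t) := (hDY ht).2
    omega
  have hanc : ∀ w, w ≠ x → G.dist x w = G.dist x b → e (u w) ≤ e (u b) →
      ∀ j, 1 ≤ j → j ≤ G.dist x w → ∀ t ∈ D, ¬ G.Adj (u^[j] w) t := by
    intro w hw hwd hle j hj1 hj t ht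
    by_cases hj' : j = 1
    · subst hj'
      exact hparD w hw hwd hle t ht
    · have := huP.dist_iterate w j hj
      have := (hDdist t ht).2
      exact IsParentMap.not_adj_of_dist (x := x) (by omega)
  have hub : ¬ G.Adj (u a) b := by
    intro hadj
    have h1 := hmin b hb.1 (u a) hadj.symm (by rw [(hu a ha.1).2, hdab])
    have h2 : e (u a) < e (u b) := hlt
    omega
  obtain ⟨P, hP⟩ := huP.exists_path b
  obtain ⟨Q, hQ⟩ := huP.exists_path_append hba.symm hdab hub
  have hra := huP.iterate_dist (fun w => (hreach w).1) a
  rw [hdab] at hra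
  refine ⟨G.dist x b, P, Q, b, D, isBall_of_ballIn hD, ?_, ?_, ?_, ?_, hbD, ?_, ?_,
    (hreach b).2⟩
  · rw [hP]
    exact huP.iterate_dist (fun w => (hreach w).1) b
  · rw [hQ]
    simpa using hra
  · rw [hP]
    simp
  · rw [hQ]
    simp
  · rintro v (⟨j, rfl⟩ | ⟨j, rfl⟩) hv t ht
    · rw [hP] at hv ⊢
      have hj : (j : ℕ) ≠ G.dist x b := by
        intro hcon
        simp [hcon] at hv
      exact hanc b hb.1 rfl le_rfl _ (by omega) (by omega) t ht
    · rw [hQ] at hv ⊢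
      by_cases hj : (j : ℕ) ≤ G.dist x b
      · rw [if_pos hj] at hv ⊢
        by_cases hj' : (j : ℕ) = G.dist x b
        · simpa [hj'] using haD t ht
        · exact hanc a ha.1 hdab hlt.le _ (by omega) (by omega) t ht
      · simp [hj] at hv
  · by_contra hcon
    rw [not_lt, chromaticNumber_le_iff_colorable, ← colOn_iff_colorable] at hcon
    exact hDc hcon
end

section
/- Let φ : ℕ → ℕ be a nondecreasing function, and let ρ ≥ 3, ℓ ≥ ρ(8ρ + 6) and τ ≥ 0. For every integer c ≥ 1 there exists an integer c' ≥ 0 with the following property. Let G be a (ρ,φ)-controlled graph such that χ^{ρ−1}(G) ≤ τ and χ(J) ≤ τ for every induced subgraph J of G with ω(J) < ω(G). Let x ∈ V(G) be such that V(G) ∖ {x} is a ρ-ball, x has a neighbour in G ∖ x, and χ(V(G) ∖ {x}) > c'. Then there is a ρ-comet (𝒫, X) in G with tip x and chromatic number more than c, whose spectrum includes {ℓ + i : 0 ≤ i ≤ 2ρ + 3}. -/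
open SimpleGraph

variable {V : Type*}

/-- There is a walk of length `n` from `x` to the last argument, all of whose vertices lie in `S`. -/
inductive WalkIn (G : SimpleGraph V) (S : Set V) (x : V) : ℕ → V → Prop
  | nil : x ∈ S → WalkIn G S x 0 x
  | snoc {n : ℕ} {v u : V} : WalkIn G S x n v → G.Adj v u → u ∈ S → WalkIn G S x (n + 1) u

namespace WalkIn

variable {G : SimpleGraph V} {S T : Set V} {x y z : V} {m n : ℕ}

theorem mem (h : WalkIn G S x n y) : y ∈ S := by
  cases h <;> assumption

theorem mem_start (h : WalkIn G S x n y) : x ∈ S := by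
  induction h <;> assumption

theorem eq_of_zero (h : WalkIn G S x 0 y) : y = x := by
  cases h; rfl

theorem mono (hST : S ⊆ T) (h : WalkIn G S x n y) : WalkIn G T x n y := by
  induction h with
  | nil h => exact .nil (hST h)
  | snoc _ ha hu ih => exact .snoc ih ha (hST hu)

theorem trans (h₁ : WalkIn G S x m y) (h₂ : WalkIn G S y n z) : WalkIn G S x (m + n) z := by
  induction h₂ with
  | nil _ => exact h₁
  | snoc _ ha hu ih => exact .snoc ih ha hu

theorem cons (hx : x ∈ S) (ha : G.Adj x y) (h : WalkIn G S y n z) : WalkIn G S x (n + 1) z := by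
  rw [add_comm]
  exact (WalkIn.snoc (.nil hx) ha h.mem_start).trans h

theorem exists_cons (h : WalkIn G S x n y) (k : ℕ) (hk : n = k + 1) :
    ∃ v, G.Adj x v ∧ WalkIn G S v k y := by
  induction h generalizing k with
  | nil _ => omega
  | @snoc n v u hw ha hu ih =>
    obtain rfl : n = k := by omega
    cases n with
    | zero =>
      obtain rfl := hw.eq_of_zero
      exact ⟨u, ha, .nil hu⟩
    | succ n =>
      obtain ⟨v', h₁, h₂⟩ := ih n rfl
      exact ⟨v', h₁, .snoc h₂ ha hu⟩

theorem of_walk {x y : S} (p : (G.induce S).Walk x y) : WalkIn G S x p.length y := by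
  induction p with
  | nil => exact .nil (Subtype.prop _)
  | @cons u v w ha p ih => exact cons u.2 ha ih

theorem exists_walk (h : WalkIn G S x n y) :
    ∃ p : (G.induce S).Walk ⟨x, h.mem_start⟩ ⟨y, h.mem⟩, p.length = n := by
  induction h with
  | nil _ => exact ⟨.nil, rfl⟩
  | @snoc n v u hw ha hu ih =>
    obtain ⟨p, hp⟩ := ih
    have ha' : (G.induce S).Adj ⟨v, hw.mem⟩ ⟨u, hu⟩ := ha
    exact ⟨p.concat ha', by rw [Walk.length_concat, hp]⟩

theorem mem_closedNbhd (h : WalkIn G S x n y) {r : ℕ} (hr : n ≤ r) : y ∈ closedNbhd G x r := by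
  induction h generalizing r with
  | nil _ => exact ⟨Reachable.refl _, by simp⟩
  | @snoc n v u _ ha _ ih =>
    obtain ⟨h₁, h₂⟩ := ih (r := r - 1) (by omega)
    have hr' : 1 ≤ r := by omega
    refine ⟨h₁.trans ha.reachable, ?_⟩
    obtain ⟨p, hp⟩ := h₁.exists_walk_length_eq_dist
    have := dist_le (p.concat ha)
    rw [Walk.length_concat] at this
    omega

/-- A vertex reached from `x` within `r` steps in `S` is so reached inside the ball itself. -/
theorem within_ball {r : ℕ} (h : WalkIn G S x n y) (hn : n ≤ r) :
    WalkIn G {u | ∃ k ≤ r, WalkIn G S x k u} x n y := by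
  induction h with
  | nil h => exact .nil ⟨0, by omega, .nil h⟩
  | snoc hw ha hu ih => exact .snoc (ih (by omega)) ha ⟨_, hn, .snoc hw ha hu⟩

theorem isBall {r : ℕ} {z : V} (hz : z ∈ S) (h : ∀ u ∈ S, ∃ n ≤ r, WalkIn G S z n u) :
    IsBall G r S := by
  refine Or.inr ⟨⟨z, hz⟩, fun u => ?_⟩
  obtain ⟨n, hn, hw⟩ := h u u.2
  obtain ⟨p, hp⟩ := hw.exists_walk
  exact ⟨p.reachable, (dist_le p).trans (hp.le.trans hn)⟩

theorem of_reachable {x y : S} {r : ℕ} (h : (G.induce S).Reachable x y)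
    (hd : (G.induce S).dist x y ≤ r) : ∃ n ≤ r, WalkIn G S x n y := by
  obtain ⟨p, hp⟩ := h.exists_walk_length_eq_dist
  exact ⟨_, hp.le.trans hd, of_walk p⟩

end WalkIn

/-- `G[S]` has a proper colouring with `n` colours. -/
def ColorableOn (G : SimpleGraph V) (S : Set V) (n : ℕ) : Prop :=
  ∃ f : V → ℕ, (∀ u ∈ S, f u < n) ∧ ∀ u ∈ S, ∀ v ∈ S, G.Adj u v → f u ≠ f v

namespace ColorableOn

variable {G : SimpleGraph V} {S T : Set V} {m n : ℕ}

theorem iff_colorable : ColorableOn G S n ↔ (G.induce S).Colorable n := by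
  classical
  constructor
  · rintro ⟨f, h₁, h₂⟩
    exact ⟨Coloring.mk (fun u : S => (⟨f u, h₁ u u.2⟩ : Fin n)) fun {u v} ha h =>
      h₂ u u.2 v v.2 ha (congrArg Fin.val h)⟩
  · rintro ⟨C⟩
    refine ⟨fun u => if h : u ∈ S then C ⟨u, h⟩ else 0, fun u hu => ?_, fun u hu v hv ha => ?_⟩
    · simp [hu]
    · have : C ⟨u, hu⟩ ≠ C ⟨v, hv⟩ := C.valid ha
      simpa [hu, hv, Fin.val_inj] using this

theorem iff_chromaticNumber_le :
    ColorableOn G S n ↔ (G.induce S).chromaticNumber ≤ (n : ℕ∞) := by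
  rw [iff_colorable, chromaticNumber_le_iff_colorable]

theorem mono (hST : S ⊆ T) (hmn : m ≤ n) (h : ColorableOn G T m) : ColorableOn G S n := by
  obtain ⟨f, h₁, h₂⟩ := h
  exact ⟨f, fun u hu => (h₁ u (hST hu)).trans_le hmn,
    fun u hu v hv => h₂ u (hST hu) v (hST hv)⟩

theorem union (hS : ColorableOn G S m) (hT : ColorableOn G T n) :
    ColorableOn G (S ∪ T) (m + n) := by
  classical
  obtain ⟨f, f₁, f₂⟩ := hS
  obtain ⟨g, g₁, g₂⟩ := hT
  refine ⟨fun u => if u ∈ S then f u else m + g u, fun u hu => ?_, fun u hu v hv ha => ?_⟩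
  · by_cases h : u ∈ S
    · have := f₁ u h
      simp only [h, if_true]; omega
    · have := g₁ u (hu.resolve_left h)
      simp only [h, if_false]; omega
  · by_cases h : u ∈ S <;> by_cases h' : v ∈ S <;> simp only [h, h', if_true, if_false]
    · exact f₂ u h v h' ha
    · have := f₁ u h; omega
    · have := f₁ v h'; omega
    · have := g₂ u (hu.resolve_left h) v (hv.resolve_left h') ha; omega

theorem biUnion {ι : Type*} (s : Finset ι) (F : ι → Set V)
    (h : ∀ i ∈ s, ColorableOn G (F i) n) : ColorableOn G (⋃ i ∈ s, F i) (s.card * n) := by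
  classical
  induction s using Finset.induction_on with
  | empty => exact ⟨fun _ => 0, by simp, by simp⟩
  | insert a s ha ih =>
    rw [Finset.set_biUnion_insert, Finset.card_insert_of_notMem ha, add_mul, one_mul, add_comm]
    exact (h a (by simp)).union (ih fun i hi => h i (by simp [hi]))

theorem of_union_left (h : ¬ ColorableOn G (S ∪ T) (m + n)) (hT : ColorableOn G T n) :
    ¬ ColorableOn G S m := fun hS => h (hS.union hT)

end ColorableOn

/-- The consequences of the hypotheses on `G` that the construction uses. -/
structure Tame (G : SimpleGraph V) (ρ τ : ℕ) (φ : ℕ → ℕ) : Prop where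
  exists_ball : ∀ S s, ¬ ColorableOn G S (φ s) →
    ∃ z ∈ S, ¬ ColorableOn G {u | ∃ n ≤ ρ, WalkIn G S z n u} s
  colorable_nbhd : ∀ v, ColorableOn G (closedNbhd G v (ρ - 1)) τ
  exists_clique : ∀ S : Set V, ¬ ColorableOn G S τ →
    ∃ K : Finset V, (K : Set V) ⊆ S ∧ G.IsNClique G.cliqueNum K

theorem Tame.of_controlled [Finite V] {G : SimpleGraph V} {ρ τ : ℕ} {φ : ℕ → ℕ} (hφ : Monotone φ)
    (h₁ : Controlled ρ φ G) (h₂ : chiRho G (ρ - 1) ≤ (τ : ℕ∞))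
    (h₃ : ∀ Y : Set V, (G.induce Y).cliqueNum < G.cliqueNum →
      (G.induce Y).chromaticNumber ≤ (τ : ℕ∞)) : Tame G ρ τ φ where
  exists_ball S s hS := by
    by_contra! hcon
    refine hS (ColorableOn.iff_chromaticNumber_le.2 ((h₁ S).trans ?_))
    have : chiRho (G.induce S) ρ ≤ (s : ℕ∞) := by
      refine iSup_le fun z => ?_
      rw [chromaticNumber_le_iff_colorable]
      obtain ⟨f, f₁, f₂⟩ := hcon z z.2
      have hmem : ∀ u ∈ closedNbhd (G.induce S) z ρ,
          (u : V) ∈ {u | ∃ n ≤ ρ, WalkIn G S z n u} := fun u hu =>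
        WalkIn.of_reachable hu.1 hu.2
      exact ⟨Coloring.mk (fun u => (⟨f u.1, f₁ _ (hmem u.1 u.2)⟩ : Fin s)) fun {u v} ha h =>
        f₂ _ (hmem u.1 u.2) _ (hmem v.1 v.2) ha (congrArg Fin.val h)⟩
    exact_mod_cast hφ (ENat.toNat_le_of_le_natCast this)
  colorable_nbhd v := ColorableOn.iff_chromaticNumber_le.2 ((le_iSup _ v).trans h₂)
  exists_clique S hS := by
    have hle : G.cliqueNum ≤ (G.induce S).cliqueNum := by
      by_contra! hlt
      exact hS (ColorableOn.iff_chromaticNumber_le.2 (h₃ S hlt))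
    obtain ⟨K, hK⟩ := (G.induce S).exists_isNClique_cliqueNum
    obtain ⟨K', hK', hcard⟩ := Finset.exists_subset_card_eq (hle.trans hK.card_eq.ge)
    refine ⟨K'.map (Function.Embedding.subtype _), ?_, ?_, ?_⟩
    · intro u hu
      simp only [Finset.coe_map, Set.mem_image] at hu
      obtain ⟨w, -, rfl⟩ := hu
      exact w.2
    · intro u hu v hv huv
      simp only [Finset.coe_map, Set.mem_image] at hu hv
      obtain ⟨u, hu, rfl⟩ := hu
      obtain ⟨v, hv, rfl⟩ := hv
      exact hK.isClique (hK' hu) (hK' hv) fun h => huv (h ▸ rfl)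
    · simpa using hcard

/-- `a :: l` is the vertex sequence of an induced path from `a` to the last argument. -/
inductive InducedPath (G : SimpleGraph V) : V → List V → V → Prop
  | nil (a : V) : InducedPath G a [] a
  | cons {a b y : V} {l : List V} : G.Adj a b → (∀ c ∈ l, ¬ G.Adj a c ∧ a ≠ c) →
      InducedPath G b l y → InducedPath G a (b :: l) y

namespace InducedPath

variable {G : SimpleGraph V} {x y z : V} {l l' : List V}

theorem end_mem (h : InducedPath G x l y) : y ∈ x :: l := by
  induction h with
  | nil a => simp
  | cons _ _ _ ih => exact List.mem_cons_of_mem _ ih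

theorem append (h : InducedPath G x l y) (h' : InducedPath G y l' z)
    (hsep : ∀ u ∈ x :: l, u ≠ y → ∀ w ∈ l', ¬ G.Adj u w ∧ u ≠ w) :
    InducedPath G x (l ++ l') z := by
  induction h with
  | nil a => exact h'
  | @cons a b y l hab hl hp ih =>
    refine .cons hab (fun c hc => ?_) (ih h' fun u hu => hsep u (List.mem_cons_of_mem _ hu))
    rcases List.mem_append.1 hc with hc | hc
    · exact hl c hc
    · refine hsep a (by simp) ?_ c hc
      rintro rfl
      rcases List.mem_cons.1 hp.end_mem with h | h
      · exact hab.ne h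
      · exact (hl _ h).2 rfl

theorem exists_embedding (h : InducedPath G x l y) :
    ∃ f : pathGraph (l.length + 1) ↪g G, f 0 = x ∧ f (Fin.last l.length) = y ∧
      ∀ i, f i ∈ x :: l := by
  induction h with
  | nil a =>
    refine ⟨⟨⟨fun _ => a, fun i j _ => Subsingleton.elim (α := Fin 1) i j⟩, ?_⟩, rfl, rfl, ?_⟩
    · intro i j
      obtain rfl : i = j := Subsingleton.elim (α := Fin 1) i j
      simp
    · intro i; simp
  | @cons a b y l hab hl hp ih =>
    obtain ⟨f, h0, h1, hm⟩ := ih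
    have key : ∀ i, (G.Adj a (f i) ↔ i = 0) ∧ a ≠ f i := by
      intro i
      rcases List.mem_cons.1 (hm i) with h | h
      · have : i = 0 := f.injective (h.trans h0.symm)
        subst this
        rw [h0]
        exact ⟨by simp [hab], hab.ne⟩
      · refine ⟨⟨fun ha => absurd ha (hl _ h).1, ?_⟩, (hl _ h).2⟩
        rintro rfl
        rw [h0]; exact hab
    refine ⟨⟨⟨Fin.cons a f, ?_⟩, ?_⟩, rfl, ?_, ?_⟩
    · rw [Fin.cons_injective_iff]
      refine ⟨?_, f.injective⟩
      rintro ⟨i, hi⟩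
      exact (key i).2 hi.symm
    · intro i j
      change G.Adj ((Fin.cons a f : Fin (l.length + 2) → V) i)
        ((Fin.cons a f : Fin (l.length + 2) → V) j) ↔ _
      rw [pathGraph_adj]
      refine Fin.cases ?_ (fun i => ?_) i <;> refine Fin.cases ?_ (fun j => ?_) j
      · simp
      · simp only [Fin.cons_zero, Fin.cons_succ, (key j).1, Fin.ext_iff, Fin.val_succ,
          Fin.val_zero]
        omega
      · simp only [Fin.cons_zero, Fin.cons_succ, G.adj_comm _ a, (key i).1, Fin.ext_iff,
          Fin.val_succ, Fin.val_zero]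
        omega
      · simp only [Fin.cons_succ]
        rw [f.map_adj_iff, pathGraph_adj]
        simp
    · exact h1
    · intro i
      refine Fin.cases ?_ (fun i => ?_) i
      · exact List.mem_cons_self
      · exact List.mem_cons_of_mem _ (hm i)

end InducedPath

/-- There is an induced path of length `n` from `x` to `y` in `B` whose vertices other than `y`
neither lie in nor are adjacent to `B' \ {y}`. -/
def Leads (G : SimpleGraph V) (x y : V) (n : ℕ) (B B' : Set V) : Prop :=
  ∃ l, InducedPath G x l y ∧ l.length = n ∧ (∀ u ∈ x :: l, u ∈ B) ∧
    ∀ u ∈ x :: l, u ≠ y → u ∉ B' ∧ ∀ w ∈ B', w ≠ y → ¬ G.Adj u w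

theorem Leads.refl {G : SimpleGraph V} {x : V} {B : Set V} (hx : x ∈ B) : Leads G x x 0 B B :=
  ⟨[], .nil x, rfl, by simpa, by simp⟩

theorem Leads.trans {G : SimpleGraph V} {x y z : V} {m n : ℕ} {A B C : Set V}
    (h : Leads G x y m A B) (h' : Leads G y z n B C) (hBA : B ⊆ A) (hCB : C ⊆ B) :
    Leads G x z (m + n) A C := by
  obtain ⟨l, h₁, h₂, h₃, h₄⟩ := h
  obtain ⟨l', h₁', h₂', h₃', h₄'⟩ := h'
  have hy : ∀ w ∈ l', w ≠ y := by
    cases h₁' with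
    | nil => simp
    | cons hab hl _ =>
      intro w hw
      rcases List.mem_cons.1 hw with rfl | hw
      · exact hab.ne'
      · exact (hl w hw).2.symm
  refine ⟨l ++ l', h₁.append h₁' fun u hu huy w hw => ?_, by simp [h₂, h₂'], fun u hu => ?_,
    fun u hu huz => ?_⟩
  · have hwB := h₃' w (List.mem_cons_of_mem _ hw)
    have := h₄ u hu huy
    exact ⟨this.2 w hwB (hy w hw), fun h => this.1 (h ▸ hwB)⟩
  · rcases List.mem_append.1 (List.cons_append ▸ hu : u ∈ (x :: l) ++ l') with hu | hu
    · exact h₃ u hu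
    · exact hBA (h₃' u (List.mem_cons_of_mem _ hu))
  · by_cases hu' : u ∈ y :: l'
    · exact h₄' u hu' huz
    · have hul : u ∈ x :: l := by
        rcases List.mem_append.1 (List.cons_append ▸ hu : u ∈ (x :: l) ++ l') with hu | hu
        · exact hu
        · exact absurd (List.mem_cons_of_mem _ hu) hu'
      have huy : u ≠ y := fun h => hu' (h ▸ List.mem_cons_self)
      obtain ⟨h₅, h₆⟩ := h₄ u hul huy
      refine ⟨fun h => h₅ (hCB h), fun w hw hwz => ?_⟩
      by_cases hwy : w = y
      · subst hwy
        intro _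
        have hwz' : w ≠ z := hwz
        exact (h₄' w List.mem_cons_self hwz').1 hw
      · exact h₆ w (hCB hw) hwy

/-- Every vertex of `B` is reached from `x ∈ B` by a walk of length at most `R` in `B`. -/
def Centred (G : SimpleGraph V) (R : ℕ) (x : V) (B : Set V) : Prop :=
  x ∈ B ∧ ∀ u ∈ B, ∃ n ≤ R, WalkIn G B x n u

theorem Centred.mono {G : SimpleGraph V} {R R' : ℕ} {x : V} {B : Set V} (h : Centred G R x B)
    (hR : R ≤ R') : Centred G R' x B :=
  ⟨h.1, fun u hu => let ⟨n, hn, hw⟩ := h.2 u hu; ⟨n, hn.trans hR, hw⟩⟩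

/-- `d` is the distance from `x` in `G[B]`, and is at most `R`. -/
structure IsLevelling (G : SimpleGraph V) (B : Set V) (x : V) (R : ℕ) (d : V → ℕ) : Prop where
  root_mem : x ∈ B
  root : d x = 0
  walk : ∀ u ∈ B, WalkIn G B x (d u) u
  parent : ∀ u ∈ B, ∀ n, d u = n + 1 → ∃ v ∈ B, d v = n ∧ G.Adj v u
  adj_le : ∀ u ∈ B, ∀ v ∈ B, G.Adj v u → d u ≤ d v + 1
  le : ∀ u ∈ B, d u ≤ R

theorem Centred.exists_levelling {G : SimpleGraph V} {R : ℕ} {x : V} {B : Set V}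
    (h : Centred G R x B) : ∃ d, IsLevelling G B x R d := by
  classical
  have hex : ∀ u ∈ B, ∃ n, WalkIn G B x n u := fun u hu =>
    let ⟨n, _, hw⟩ := h.2 u hu; ⟨n, hw⟩
  have spec : ∀ u ∈ B, WalkIn G B x (sInf {n | WalkIn G B x n u}) u := fun u hu =>
    Nat.sInf_mem (s := {n | WalkIn G B x n u}) (hex u hu)
  have min : ∀ u n, WalkIn G B x n u → sInf {n | WalkIn G B x n u} ≤ n := fun u n hw =>
    Nat.sInf_le hw
  refine ⟨fun u => sInf {n | WalkIn G B x n u}, h.1, ?_, spec, ?_, ?_, ?_⟩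
  · exact Nat.le_zero.1 (min x 0 (.nil h.1))
  · intro u hu n hn
    have hw := spec u hu
    rw [hn] at hw
    cases hw with
    | @snoc _ v _ hw ha _ =>
      refine ⟨v, hw.mem, le_antisymm (min _ _ hw) ?_, ha⟩
      have := min _ _ (.snoc (spec v hw.mem) ha hu)
      omega
  · intro u hu v hv ha
    exact min _ _ (.snoc (spec v hv) ha hu)
  · intro u hu
    obtain ⟨n, hn, hw⟩ := h.2 u hu
    exact (min _ _ hw).trans hn

namespace IsLevelling

variable {G : SimpleGraph V} {B : Set V} {x v y : V} {R : ℕ} {d : V → ℕ} {l : List V}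

theorem eq_root (h : IsLevelling G B x R d) (hv : v ∈ B) (h0 : d v = 0) : v = x := by
  have := h.walk v hv
  rw [h0] at this
  exact this.eq_of_zero

/-- A path leaving `v` away from the root extends backwards, along a geodesic, to the root. -/
theorem exists_prepend (h : IsLevelling G B x R d) (hp : InducedPath G v l y) (hv : v ∈ B)
    (hl : ∀ w ∈ l, w ∈ B ∧ d v + 1 ≤ d w) :
    ∃ l', InducedPath G x l' y ∧ l'.length = l.length + d v ∧
      ∀ u ∈ x :: l', u ∈ v :: l ∨ u ∈ B ∧ d u < d v := by
  generalize hn : d v = n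
  induction n generalizing v l with
  | zero =>
    obtain rfl := h.eq_root hv hn
    exact ⟨l, hp, rfl, fun u hu => .inl hu⟩
  | succ n ih =>
    obtain ⟨v', hv', hd, ha⟩ := h.parent v hv n hn
    have hp' : InducedPath G v' (v :: l) y := by
      refine .cons ha (fun w hw => ⟨fun haw => ?_, ?_⟩) hp
      · have := h.adj_le w (hl w hw).1 v' hv' haw
        have := (hl w hw).2
        omega
      · rintro rfl
        have := (hl v' hw).2
        omega
    obtain ⟨l', h₁, h₂, h₃⟩ := ih hp' hv' (by
      intro w hw
      rcases List.mem_cons.1 hw with rfl | hw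
      · exact ⟨hv, by omega⟩
      · exact ⟨(hl w hw).1, by have := (hl w hw).2; omega⟩) hd
    refine ⟨l', h₁, by rw [h₂, List.length_cons]; omega, fun u hu => ?_⟩
    rcases h₃ u hu with h | h
    · rcases List.mem_cons.1 h with rfl | h
      · exact .inr ⟨hv', by omega⟩
      · exact .inl h
    · exact .inr ⟨h.1, by omega⟩

end IsLevelling

theorem WalkIn.symm {G : SimpleGraph V} {S : Set V} {x y : V} {n : ℕ} (h : WalkIn G S x n y) :
    WalkIn G S y n x := by
  induction h with
  | nil h => exact .nil h
  | snoc _ ha hu ih => exact ih.cons hu ha.symm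

/-- The vertices lying on walks of length `n` from `m` to `z` in `S`. -/
def walkSegment (G : SimpleGraph V) (S : Set V) (m z : V) (n : ℕ) : Set V :=
  {u | ∃ i j, i + j = n ∧ WalkIn G S m i u ∧ WalkIn G S u j z}

section WalkSegment

variable {G : SimpleGraph V} {S Q : Set V} {m z u : V} {n i j r : ℕ}

theorem walkSegment_subset : walkSegment G S m z n ⊆ S := fun _ ⟨_, _, _, h, _⟩ => h.mem

theorem WalkIn.in_walkSegment (h : WalkIn G S m i u) (h' : WalkIn G S u j z) (hn : i + j = n) :
    WalkIn G (walkSegment G S m z n) m i u := by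
  induction h generalizing j with
  | nil h => exact .nil ⟨0, j, hn, .nil h, h'⟩
  | snoc hw ha hu ih =>
    exact .snoc (ih (h'.cons hw.mem ha) (by omega)) ha ⟨_, _, hn, .snoc hw ha hu, h'⟩

theorem centred_walkSegment_union (h : WalkIn G S m n z) (hQ : ∀ u ∈ Q, ∃ k ≤ r, WalkIn G Q z k u) :
    Centred G (n + r) m (walkSegment G S m z n ∪ Q) := by
  have hz : WalkIn G (walkSegment G S m z n) m n z := h.in_walkSegment (.nil h.mem) (by omega)
  refine ⟨.inl hz.mem_start, ?_⟩
  rintro u (⟨i, j, hij, h₁, h₂⟩ | hu)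
  · exact ⟨i, by omega, (h₁.in_walkSegment h₂ hij).mono Set.subset_union_left⟩
  · obtain ⟨k, hk, hw⟩ := hQ u hu
    exact ⟨n + k, by omega,
      (hz.mono Set.subset_union_left).trans (hw.mono Set.subset_union_right)⟩

theorem WalkIn.in_walkSegment_diff (hmin : ∀ j, WalkIn G S m j z → n ≤ j) (hi : 1 ≤ i)
    (h : WalkIn G S m i u) (h' : WalkIn G S u j z) (hn : i + j = n) :
    WalkIn G (walkSegment G S m z n \ {m}) z j u := by
  induction j generalizing i u with
  | zero =>
    obtain rfl := h'.eq_of_zero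
    refine .nil ⟨⟨i, 0, hn, h, h'⟩, ?_⟩
    rintro rfl
    have := hmin 0 h'
    omega
  | succ j ih =>
    obtain ⟨v, ha, hv⟩ := h'.exists_cons j rfl
    refine .snoc (ih (by omega) (.snoc h ha hv.mem_start) hv (by omega)) ha.symm
      ⟨⟨i, j + 1, hn, h, h'⟩, ?_⟩
    rintro rfl
    have := hmin _ h'
    omega

end WalkSegment

namespace IsLevelling

variable {G : SimpleGraph V} {B : Set V} {x y z : V} {R n s : ℕ} {d : V → ℕ}

theorem le_add (h : IsLevelling G B x R d) (hw : WalkIn G B y n z) : d z ≤ d y + n := by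
  induction hw with
  | nil _ => simp
  | snoc hw ha hu ih =>
    have := h.adj_le _ hu _ hw.mem ha
    omega

theorem exists_ancestor (h : IsLevelling G B x R d) (hz : z ∈ B) (hd : d z = s + n) :
    ∃ y ∈ B, d y = s ∧ WalkIn G B y n z := by
  induction n generalizing z with
  | zero => exact ⟨z, hz, hd, .nil hz⟩
  | succ n ih =>
    obtain ⟨v, hv, hdv, ha⟩ := h.parent z hz _ hd
    obtain ⟨y, hy, hdy, hw⟩ := ih hv hdv
    exact ⟨y, hy, hdy, .snoc hw ha hz⟩

end IsLevelling

section

variable {G : SimpleGraph V} {ρ τ R c k s : ℕ} {φ : ℕ → ℕ} {x : V} {B : Set V} {d : V → ℕ}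

theorem IsLevelling.exists_level (hT : Tame G ρ τ φ) (hρ : 2 ≤ ρ) (h : IsLevelling G B x R d)
    (hB : ¬ ColorableOn G B ((R + 1) * (c + τ))) :
    ∃ k, 2 ≤ k ∧ k ≤ R ∧ ¬ ColorableOn G {u | u ∈ B ∧ d u = k} c := by
  by_contra! hcon
  refine hB ?_
  have := ColorableOn.biUnion (G := G) (n := c + τ) (Finset.range (R + 1))
    (fun k => {u | u ∈ B ∧ d u = k}) fun k hk => by
      by_cases h2 : 2 ≤ k
      · exact (hcon k h2 (by simpa [Nat.lt_succ_iff] using hk)).mono subset_rfl (by omega)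
      · refine (hT.colorable_nbhd x).mono ?_ (by omega)
        rintro u ⟨hu, hd⟩
        exact (h.walk u hu).mem_closedNbhd (by omega)
  rw [Finset.card_range] at this
  refine this.mono (fun u hu => ?_) le_rfl
  simp only [Set.mem_iUnion, Finset.mem_range]
  exact ⟨d u, Nat.lt_succ_of_le (h.le u hu), hu, rfl⟩

theorem IsLevelling.exists_truncation (hT : Tame G ρ τ φ) (h : IsLevelling G B x R d)
    (hk : ¬ ColorableOn G {u | u ∈ B ∧ d u = k} (φ c)) (hs : s < k) :
    ∃ y B', B' ⊆ B ∧ Leads G x y s B B' ∧ Centred G (k - s + ρ) y B' ∧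
      ¬ ColorableOn G (B' \ {y}) c ∧ (∃ w ∈ B' \ {y}, G.Adj y w) ∧
      (k ≤ s + 1 + ρ → IsBall G ρ (B' \ {y})) := by
  obtain ⟨z, ⟨hzB, hdz⟩, hQ⟩ := hT.exists_ball _ _ hk
  set Q := {u | ∃ n ≤ ρ, WalkIn G {u | u ∈ B ∧ d u = k} z n u} with hQdef
  have hQL : ∀ u ∈ Q, u ∈ B ∧ d u = k := fun u ⟨_, _, hw⟩ => hw.mem
  have hQw : ∀ u ∈ Q, ∃ n ≤ ρ, WalkIn G Q z n u := fun u ⟨n, hn, hw⟩ =>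
    ⟨n, hn, hw.within_ball hn⟩
  have hzQ : z ∈ Q := ⟨0, by omega, .nil ⟨hzB, hdz⟩⟩
  obtain ⟨y, hy, hdy, hw⟩ := h.exists_ancestor (s := s) (n := k - s) hzB (by omega)
  have hmin : ∀ j, WalkIn G B y j z → k - s ≤ j := fun j hj => by
    have := h.le_add hj
    omega
  have hyQ : y ∉ Q := fun hyQ => by
    have := (hQL y hyQ).2
    omega
  set B' := walkSegment G B y z (k - s) ∪ Q with hB'
  have hlev : ∀ w ∈ B', w ∈ B ∧ (w ≠ y → s + 1 ≤ d w) := by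
    rintro w (⟨i, j, hij, h₁, h₂⟩ | hw')
    · refine ⟨h₁.mem, fun hne => ?_⟩
      have h3 := h.le_add h₂
      have : i ≠ 0 := by
        rintro rfl
        exact hne h₁.eq_of_zero
      omega
    · have := hQL w hw'
      exact ⟨this.1, fun _ => by omega⟩
  refine ⟨y, B', fun w hw => (hlev w hw).1, ?_, centred_walkSegment_union hw hQw, ?_, ?_, ?_⟩
  · obtain ⟨l, h₁, h₂, h₃⟩ := h.exists_prepend (.nil y) hy (by simp)
    have h₃' : ∀ u ∈ x :: l, u = y ∨ u ∈ B ∧ d u < s := by simpa [hdy] using h₃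
    refine ⟨l, h₁, by simpa [hdy] using h₂, fun u hu => ?_, fun u hu huy => ?_⟩
    · rcases h₃' u hu with rfl | hu
      exacts [hy, hu.1]
    · obtain ⟨huB, hdu⟩ := (h₃' u hu).resolve_left huy
      refine ⟨fun hu' => ?_, fun w hw hwy ha => ?_⟩
      · have := (hlev u hu').2 huy
        omega
      · have h4 := (hlev w hw).2 hwy
        have := h.adj_le w (hlev w hw).1 u huB ha
        omega
  · have hsub : Q ⊆ B' \ {y} := fun u hu => ⟨.inr hu, fun h => hyQ (h ▸ hu)⟩
    exact fun hc => hQ (hc.mono hsub le_rfl)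
  · have hw' : WalkIn G (walkSegment G B y z (k - s)) y (k - s) z :=
      hw.in_walkSegment (.nil hzB) (by omega)
    obtain ⟨v, ha, hv⟩ := hw'.exists_cons (k - s - 1) (by omega)
    exact ⟨v, ⟨.inl hv.mem_start, ha.ne'⟩, ha⟩
  · intro hks
    have hsub : walkSegment G B y z (k - s) \ {y} ⊆ B' \ {y} :=
      Set.sdiff_subset_sdiff_left Set.subset_union_left
    refine WalkIn.isBall (z := z) ⟨.inr hzQ, fun h => hyQ (h ▸ hzQ)⟩ ?_
    rintro u ⟨⟨i, j, hij, h₁, h₂⟩ | hu, huy⟩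
    · have hi : i ≠ 0 := by
        rintro rfl
        exact huy h₁.eq_of_zero
      exact ⟨j, by omega, (h₁.in_walkSegment_diff hmin (by omega) h₂ hij).mono hsub⟩
    · obtain ⟨n, hn, hw⟩ := hQw u hu
      exact ⟨n, hn, hw.mono fun v hv => ⟨.inr hv, fun h => hyQ (h ▸ hv)⟩⟩

theorem Centred.exists_single (hT : Tame G ρ τ φ) (hρ : 2 ≤ ρ) (h : Centred G R x B)
    (hB : ¬ ColorableOn G B ((R + 1) * (φ c + τ))) :
    ∃ y B' t, 1 ≤ t ∧ t + 1 ≤ R ∧ B' ⊆ B ∧ Leads G x y t B B' ∧ Centred G (ρ + 1) y B' ∧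
      ¬ ColorableOn G B' c := by
  obtain ⟨d, hd⟩ := h.exists_levelling
  obtain ⟨k, hk, hkR, hc⟩ := hd.exists_level hT hρ hB
  obtain ⟨y, B', h₁, h₂, h₃, h₄, -⟩ := hd.exists_truncation hT hc (s := k - 1) (by omega)
  refine ⟨y, B', k - 1, by omega, by omega, h₁, h₂, h₃.mono (by omega),
    fun hc => h₄ (hc.mono Set.sdiff_subset le_rfl)⟩

end

/-- In a set of large chromatic number, an induced path of any prescribed length leads from the
centre to a ball of large chromatic number. -/
theorem exists_leads_isBall (ρ τ : ℕ) (φ : ℕ → ℕ) (hρ : 2 ≤ ρ) (c N : ℕ) :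
    ∃ c', ∀ e < N, ∀ (V : Type) (G : SimpleGraph V) (x : V) (B : Set V), Tame G ρ τ φ →
      Centred G (ρ + 1) x B → ¬ ColorableOn G B c' →
      ∃ y B', B' ⊆ B ∧ Leads G x y e B B' ∧ IsBall G ρ (B' \ {y}) ∧
        (∃ w ∈ B' \ {y}, G.Adj y w) ∧ ¬ ColorableOn G (B' \ {y}) c := by
  induction N with
  | zero => exact ⟨0, by omega⟩
  | succ N ih =>
    obtain ⟨c₀, hc₀⟩ := ih
    refine ⟨c₀ + (ρ + 1 + 1) * (max (φ c) (φ c₀) + τ), fun e he V G x B hT hC hB => ?_⟩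
    obtain ⟨d, hd⟩ := hC.exists_levelling
    obtain ⟨k, hk, hkR, hcol⟩ := hd.exists_level (c := max (φ c) (φ c₀)) hT hρ
      fun h => hB (h.mono subset_rfl (by omega))
    by_cases hek : e < k
    · obtain ⟨y, B', h₁, h₂, h₃, h₄, h₅, h₆⟩ := hd.exists_truncation (c := c) (s := e) hT
        (fun h => hcol (h.mono subset_rfl (le_max_left _ _))) hek
      exact ⟨y, B', h₁, h₂, h₆ (by omega), h₅, h₄⟩
    · obtain ⟨y, B', h₁, h₂, h₃, h₄, -⟩ := hd.exists_truncation (c := c₀) (s := k - 1) hT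
        (fun h => hcol (h.mono subset_rfl (le_max_right _ _))) (by omega)
      obtain ⟨y', B'', h₁', h₂', h⟩ := hc₀ (e - (k - 1)) (by omega) V G y B' hT
        (h₃.mono (by omega)) fun hc => h₄ (hc.mono Set.sdiff_subset le_rfl)
      refine ⟨y', B'', h₁'.trans h₁, ?_, h⟩
      have := h₂.trans h₂' h₁ h₁'
      rwa [show k - 1 + (e - (k - 1)) = e by omega] at this

section

variable {G : SimpleGraph V} {ρ τ R k n : ℕ} {φ : ℕ → ℕ} {x : V} {B H : Set V} {d i : V → ℕ}
  {par : V → V}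

/-- Each vertex of `H` has a neighbour `par v`, and `i` orders these neighbours so that `par v` is
not adjacent to the vertices of larger index. -/
structure IsIndexing (G : SimpleGraph V) (H : Set V) (i : V → ℕ) (par : V → V) : Prop where
  adj : ∀ v ∈ H, G.Adj (par v) v
  not_adj : ∀ u ∈ H, ∀ v ∈ H, i v < i u → ¬ G.Adj (par v) u
  par_eq : ∀ u ∈ H, ∀ v ∈ H, i u = i v → par u = par v

theorem IsLevelling.exists_indexing [Countable V] (h : IsLevelling G B x R d) (hk : 1 ≤ k) :
    ∃ i par, IsIndexing G {u | u ∈ B ∧ d u = k} i par ∧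
      ∀ v ∈ {u | u ∈ B ∧ d u = k}, par v ∈ B ∧ d (par v) = k - 1 := by
  classical
  obtain ⟨num, hnum⟩ := exists_injective_nat V
  let S : V → Set ℕ := fun v => {n | ∃ p ∈ B, d p = k - 1 ∧ G.Adj p v ∧ num p = n}
  have hS : ∀ v, ∃ p, v ∈ {u | u ∈ B ∧ d u = k} →
      p ∈ B ∧ d p = k - 1 ∧ G.Adj p v ∧ num p = sInf (S v) := by
    intro v
    by_cases hv : v ∈ {u | u ∈ B ∧ d u = k}
    · obtain ⟨p, hp, hd, ha⟩ := h.parent v hv.1 (k - 1) (by have := hv.2; omega)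
      obtain ⟨q, hq⟩ : sInf (S v) ∈ S v := Nat.sInf_mem ⟨num p, p, hp, hd, ha, rfl⟩
      exact ⟨q, fun _ => hq⟩
    · exact ⟨v, fun hv' => absurd hv' hv⟩
  choose par hpar using hS
  refine ⟨fun v => sInf (S v), par, ⟨fun v hv => (hpar v hv).2.2.1, ?_, ?_⟩,
    fun v hv => ⟨(hpar v hv).1, (hpar v hv).2.1⟩⟩
  · intro u hu v hv hlt ha
    obtain ⟨h₁, h₂, -, h₄⟩ := hpar v hv
    have : sInf (S u) ≤ num (par v) := Nat.sInf_le ⟨par v, h₁, h₂, ha, rfl⟩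
    omega
  · intro u hu v hv he
    refine hnum ?_
    rw [(hpar u hu).2.2.2, (hpar v hv).2.2.2]
    exact he

theorem IsIndexing.exists_subset_index_ne (hT : Tame G ρ τ φ) (hρ : 2 ≤ ρ)
    (h : IsIndexing G H i par) (hH : ¬ ColorableOn G H (τ * n)) :
    ∃ H' ⊆ H, ¬ ColorableOn G H' n ∧ ∀ u ∈ H', ∀ v ∈ H', G.Adj u v → i u ≠ i v := by
  choose f hf₁ hf₂ using hT.colorable_nbhd
  have hmem : ∀ v ∈ H, v ∈ closedNbhd G (par v) (ρ - 1) := fun v hv =>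
    WalkIn.mem_closedNbhd (S := Set.univ) (.snoc (.nil trivial) (h.adj v hv) trivial) (by omega)
  by_contra! hcon
  refine hH ?_
  have := ColorableOn.biUnion (G := G) (n := n) (Finset.range τ)
    (fun j => {v | v ∈ H ∧ f (par v) v = j}) fun j _ => by
      by_contra hj
      obtain ⟨u, ⟨hu, huj⟩, v, ⟨hv, hvj⟩, ha, hi⟩ := hcon _ (fun v hv => hv.1) hj
      have he := h.par_eq u hu v hv hi
      refine hf₂ (par v) u (he ▸ hmem u hu) v (hmem v hv) ha ?_
      rw [hvj, ← he, huj]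
  rw [Finset.card_range] at this
  refine this.mono (fun u hu => ?_) le_rfl
  simp only [Set.mem_iUnion, Finset.mem_range]
  exact ⟨_, hf₁ (par u) u (hmem u hu), hu, rfl⟩

/-- The vertices of `H` that have the largest index in some maximum clique within `H`. -/
def cliqueTops (G : SimpleGraph V) (i : V → ℕ) (H : Set V) : Set V :=
  {v | v ∈ H ∧ ∃ K : Finset V, (K : Set V) ⊆ H ∧ G.IsNClique G.cliqueNum K ∧ v ∈ K ∧
    ∀ u ∈ K, i u ≤ i v}

theorem cliqueTops_subset : cliqueTops G i H ⊆ H := fun _ h => h.1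

theorem not_colorableOn_cliqueTops [Finite V] (hT : Tame G ρ τ φ)
    (hH : ¬ ColorableOn G H (n + τ)) : ¬ ColorableOn G (cliqueTops G i H) n := by
  have hunion : cliqueTops G i H ∪ (H \ cliqueTops G i H) = H :=
    Set.union_sdiff_cancel cliqueTops_subset
  rw [← hunion] at hH
  refine ColorableOn.of_union_left hH ?_
  by_contra hcol
  obtain ⟨K, hK, hKc⟩ := hT.exists_clique _ hcol
  have hne : K.Nonempty := by
    rw [Finset.nonempty_iff_ne_empty]
    rintro rfl
    have h0 : G.cliqueNum = 0 := by simpa using hKc.card_eq.symm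
    refine hcol ⟨fun _ => 0, fun u _ => ?_, fun u _ v _ ha => ?_⟩
    all_goals
      have h1 : G.IsClique (({u} : Finset V) : Set V) := by simp
      have := h1.card_le_cliqueNum
      simp [h0] at this
  obtain ⟨v, hv, hmax⟩ := K.exists_max_image i hne
  exact (hK hv).2 ⟨(hK hv).1, K, fun u hu => (hK hu).1, hKc, hv, hmax⟩

theorem exists_not_adj_of_isNClique [Finite V] {K : Finset V} (hK : G.IsNClique G.cliqueNum K)
    {v : V} (hv : v ∉ K) : ∃ u ∈ K, ¬ G.Adj u v := by
  classical
  by_contra! hcon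
  have := (hK.insert fun u hu => (hcon u hu).symm).isClique.card_le_cliqueNum
  rw [Finset.card_insert_of_notMem hv, hK.card_eq] at this
  omega

theorem Tame.card_clique_le (hT : Tame G ρ τ φ) (hρ : 2 ≤ ρ) {K : Finset V}
    (hK : G.IsClique (K : Set V)) : K.card ≤ τ := by
  rcases K.eq_empty_or_nonempty with rfl | ⟨v, hv⟩
  · simp
  obtain ⟨f, hf₁, hf₂⟩ := hT.colorable_nbhd v
  have hmem : ∀ u ∈ K, u ∈ closedNbhd G v (ρ - 1) := by
    intro u hu
    by_cases huv : v = u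
    · subst huv
      exact WalkIn.mem_closedNbhd (S := Set.univ) (.nil trivial) (Nat.zero_le _)
    · exact WalkIn.mem_closedNbhd (S := Set.univ) (.snoc (.nil trivial) (hK hv hu huv) trivial)
        (by omega)
  have := Finset.card_le_card_of_injOn (s := K) (t := Finset.range τ) f
    (fun u hu => by simpa using hf₁ u (hmem u hu)) fun u hu w hw he => by
      by_contra hne
      exact hf₂ u (hmem u hu) w (hmem w hw) (hK hu hw hne) he
  simpa using this

/-- The case analysis producing two paths to `m` of consecutive lengths. -/
theorem exists_consecutive {F : Set V} {a b c m z : V} {P : ℕ → Prop}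
    (hidx : ∀ u ∈ F, G.Adj u m → i u ≠ i m)
    (hP : ∀ f ∈ F, ∀ l, InducedPath G f l m → (∀ w ∈ l, (w = m ∨ w ∈ F) ∧ i f < i w) →
      P l.length)
    (hP₀ : ∀ f ∈ F, i f = i m → P 0) (hm : m ∉ F)
    (hzF : z ∈ F) (haF : a ∈ F) (hbF : b ∈ F) (hcF : c ∈ F) (hzm : G.Adj z m) (ham : i a ≤ i m)
    (hz : ∃ u ∈ F, ¬ G.Adj u m ∧ (u ≠ z → G.Adj u z ∧ i u < i z))
    (ha : ∃ u ∈ F, ¬ G.Adj u m ∧ (u ≠ a → G.Adj u a ∧ i u < i a))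
    (haz : a ≠ z → G.Adj a z ∧ i a < i z ∧ G.Adj b a ∧ ¬ G.Adj b z ∧ i b < i a ∧ G.Adj c b ∧
      ¬ G.Adj c a ∧ i c < i b) :
    ∃ t ≤ 3, P t ∧ P (t + 1) := by
  have hne : ∀ u ∈ F, u ≠ m := fun u hu h => hm (h ▸ hu)
  have p2 : ∀ f ∈ F, G.Adj f m → i f < i m → P 1 := fun f hf hfm hi =>
    hP f hf [m] (.cons hfm (by simp) (.nil _)) (by simpa using hi)
  have p3 : ∀ f ∈ F, ∀ g ∈ F, G.Adj f g → G.Adj g m → ¬ G.Adj f m → i f < i g → i f < i m →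
      P 2 := fun f hf g hg h₁ h₂ h₃ h₄ h₅ =>
    hP f hf [g, m] (.cons h₁ (by simp [h₃, hne f hf]) (.cons h₂ (by simp) (.nil _)))
      (by simp [hg, h₄, h₅])
  have neighbour : ∀ f ∈ F, G.Adj f m → i f < i m →
      (∃ u ∈ F, ¬ G.Adj u m ∧ (u ≠ f → G.Adj u f ∧ i u < i f)) → ∃ t ≤ 3, P t ∧ P (t + 1) := by
    rintro f hf hfm hi ⟨u, hu, hum, huf⟩
    obtain ⟨h₁, h₂⟩ := huf fun h => hum (h ▸ hfm)
    exact ⟨1, by omega, p2 f hf hfm hi, p3 u hu f hf h₁ hfm hum h₂ (by omega)⟩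
  rcases lt_or_gt_of_ne (hidx z hzF hzm) with hlt | hlt
  · exact neighbour z hzF hzm hlt hz
  have hazne : a ≠ z := by
    rintro rfl
    omega
  obtain ⟨e₁, e₂, e₃, e₄, e₅, e₆, e₇, e₈⟩ := haz hazne
  by_cases ham' : G.Adj a m
  · exact neighbour a haF ham' (lt_of_le_of_ne ham (hidx a haF ham')) ha
  have hbz : b ≠ z := by
    rintro rfl
    omega
  have p4 : ¬ G.Adj b m → P 3 := fun hbm =>
    hP b hbF [a, z, m] (.cons e₃ (by simp [e₄, hbm, hbz, hne b hbF])
      (.cons e₁ (by simp [ham', hne a haF]) (.cons hzm (by simp) (.nil _))))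
      (by simp [haF, hzF, e₅, e₅.trans e₂, e₅.trans_le ham])
  rcases ham.lt_or_eq with ham | ham
  · have h2 := p3 a haF z hzF e₁ hzm ham' e₂ ham
    by_cases hbm : G.Adj b m
    · exact ⟨1, by omega, p2 b hbF hbm (by omega), h2⟩
    · exact ⟨2, by omega, h2, p4 hbm⟩
  · have h0 := hP₀ a haF ham
    by_cases hbm : G.Adj b m
    · exact ⟨0, by omega, h0, p2 b hbF hbm (by omega)⟩
    by_cases hcm : G.Adj c m
    · exact ⟨0, by omega, h0, p2 c hcF hcm (by omega)⟩
    by_cases hcz : G.Adj c z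
    · exact ⟨2, by omega, p3 c hcF z hzF hcz hzm hcm (by omega) (by omega), p4 hbm⟩
    have hca : c ≠ a := by
      rintro rfl
      omega
    have hcz' : c ≠ z := by
      rintro rfl
      omega
    refine ⟨3, le_rfl, p4 hbm, hP c hcF [b, a, z, m] (.cons e₆ (by
      simp [e₇, hcz, hcm, hca, hcz', hne c hcF]) (.cons e₃ (by simp [e₄, hbm, hbz, hne b hbF])
      (.cons e₁ (by simp [ham', hne a haF]) (.cons hzm (by simp) (.nil _))))) ?_⟩
    simp only [List.mem_cons, List.not_mem_nil, or_false]
    rintro w (rfl | rfl | rfl | rfl)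
    · exact ⟨.inr hbF, e₈⟩
    · exact ⟨.inr haF, by omega⟩
    · exact ⟨.inr hzF, by omega⟩
    · exact ⟨.inl rfl, by omega⟩

end

section

variable {G : SimpleGraph V} {ρ τ R c : ℕ} {φ : ℕ → ℕ} {x z : V} {B H : Set V}

/-- A ball about `z` of large chromatic number contains a large part which, except for a neighbour
`m` of `z`, is far from a given finite set `U` containing `z`. -/
theorem Tame.exists_far (hT : Tame G ρ τ φ) (hρ : 2 ≤ ρ) {U : Finset V} (hz : z ∈ U)
    (hX : ¬ ColorableOn G {u | ∃ n ≤ ρ, WalkIn G H z n u} (φ c + U.card * τ)) :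
    ∃ m B', G.Adj z m ∧ B' ⊆ H ∧ Centred G (2 * ρ - 1) m B' ∧ ¬ ColorableOn G B' c ∧
      ∀ u ∈ U, ∀ w ∈ B', u ≠ w ∧ (w ≠ m → ¬ G.Adj u w) := by
  set X := {u | ∃ n ≤ ρ, WalkIn G H z n u} with hXdef
  set N := ⋃ u ∈ U, closedNbhd G u (ρ - 1) with hN
  have hW : ¬ ColorableOn G (X \ N) (φ c) := by
    refine ColorableOn.of_union_left (T := N) (n := U.card * τ) (fun h => hX (h.mono ?_ le_rfl))
      (ColorableOn.biUnion U _ fun u _ => hT.colorable_nbhd u)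
    rw [Set.sdiff_union_self]
    exact Set.subset_union_left
  obtain ⟨z₂, ⟨⟨n, hn, hw⟩, hz₂⟩, hQ⟩ := hT.exists_ball _ _ hW
  set Q := {u | ∃ n ≤ ρ, WalkIn G (X \ N) z₂ n u} with hQdef
  have far : ∀ u ∈ U, ∀ w ∉ N, ∀ S j, WalkIn G S u j w → ρ ≤ j := by
    intro u hu w hw S j hj
    by_contra! hlt
    refine hw ?_
    rw [hN, Set.mem_iUnion₂]
    exact ⟨u, hu, hj.mem_closedNbhd (by omega)⟩
  have hnρ := far z hz z₂ hz₂ _ _ hw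
  obtain ⟨m, hzm, hm⟩ := hw.exists_cons (ρ - 1) (by omega)
  have hQX : Q ⊆ X \ N := fun u ⟨_, _, hu⟩ => hu.mem
  refine ⟨m, walkSegment G H m z₂ (ρ - 1) ∪ Q, hzm, ?_, ?_, ?_, ?_⟩
  · refine Set.union_subset walkSegment_subset (hQX.trans ?_)
    rintro u ⟨⟨_, _, hu⟩, -⟩
    exact hu.mem
  · refine (centred_walkSegment_union hm (r := ρ) ?_).mono (by omega)
    rintro u ⟨n, hn, hu⟩
    exact ⟨n, hn, hu.within_ball hn⟩
  · exact fun h => hQ (h.mono Set.subset_union_right le_rfl)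
  · rintro u hu w (⟨i, j, hij, h₁, h₂⟩ | hwQ)
    · refine ⟨?_, fun hwm ha => ?_⟩
      · rintro rfl
        have := far u hu z₂ hz₂ _ _ h₂
        omega
      · have hi : i ≠ 0 := by
          rintro rfl
          exact hwm h₁.eq_of_zero
        have := far u hu z₂ hz₂ Set.univ _ ((h₂.mono (Set.subset_univ _)).cons trivial ha)
        omega
    · have hwN := (hQX hwQ).2
      refine ⟨?_, fun _ ha => ?_⟩
      · rintro rfl
        have := far u hu u hwN Set.univ _ (.nil trivial)
        omega
      · have := far u hu w hwN Set.univ _ (.snoc (.nil trivial) ha trivial)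
        omega

theorem Centred.exists_double [Finite V] (hT : Tame G ρ τ φ) (hρ : 2 ≤ ρ) (h : Centred G R x B)
    (hB : ¬ ColorableOn G B
      ((R + 1) * (τ * (φ (φ c + 6 * τ * τ) + τ + τ) + τ))) :
    ∃ y B' t, t ≤ R + 3 ∧ B' ⊆ B ∧ Leads G x y t B B' ∧ Leads G x y (t + 1) B B' ∧
      Centred G (2 * ρ - 1) y B' ∧ ¬ ColorableOn G B' c := by
  classical
  obtain ⟨d, hd⟩ := h.exists_levelling
  obtain ⟨k, hk, hkR, hL⟩ := hd.exists_level hT hρ hB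
  obtain ⟨i, par, hi, hpar⟩ := hd.exists_indexing (k := k) (by omega)
  set L := {u | u ∈ B ∧ d u = k} with hLdef
  obtain ⟨H₀, hH₀, hcol, hidx⟩ := hi.exists_subset_index_ne hT hρ hL
  set H₁ := cliqueTops G i H₀ with hH₁
  set H₂ := cliqueTops G i H₁ with hH₂
  have h₂ : ¬ ColorableOn G H₂ (φ (φ c + 6 * τ * τ)) :=
    not_colorableOn_cliqueTops hT (not_colorableOn_cliqueTops hT hcol)
  have h₁₀ : H₁ ⊆ H₀ := cliqueTops_subset
  have h₂₁ : H₂ ⊆ H₁ := cliqueTops_subset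
  obtain ⟨z, hz, hX⟩ := hT.exists_ball _ _ h₂
  obtain ⟨a, ⟨haH, haz⟩, hamin⟩ := Set.exists_min_image {u | u ∈ H₂ ∧ (u = z ∨ G.Adj z u)} i
    (Set.toFinite _) ⟨z, hz, .inl rfl⟩
  obtain ⟨-, Kz, hKz, hKzc, hzK, hzmax⟩ := id hz
  obtain ⟨-, Ka, hKa, hKac, haK, hamax⟩ := id haH
  have tops : ∀ K : Finset V, (K : Set V) ⊆ H₀ → G.IsClique (K : Set V) → ∀ f ∈ K,
      (∀ u ∈ K, i u ≤ i f) → ∀ u ∈ K, u ≠ f → G.Adj u f ∧ i u < i f := by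
    intro K hK hKc f hf hmax u hu huf
    have hadj := hKc hu hf huf
    exact ⟨hadj, lt_of_le_of_ne (hmax u hu) (hidx u (hK hu) f (hK hf) hadj)⟩
  have hztop := tops Kz (hKz.trans h₁₀) hKzc.isClique z hzK hzmax
  have hatop := tops Ka (hKa.trans h₁₀) hKac.isClique a haK hamax
  have haz' : a ≠ z → G.Adj a z ∧ i a < i z := fun hne => by
    have hadj := (haz.resolve_left hne).symm
    exact ⟨hadj, lt_of_le_of_ne (hamin z ⟨hz, .inl rfl⟩)
      (hidx a (h₁₀ (h₂₁ haH)) z (h₁₀ (h₂₁ hz)) hadj)⟩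
  obtain ⟨b, hbK, hb⟩ : ∃ b ∈ Ka, a ≠ z → ¬ G.Adj b z := by
    by_cases hne : a = z
    · exact ⟨a, haK, fun h => absurd hne h⟩
    · obtain ⟨b, hb, hbz⟩ := exists_not_adj_of_isNClique hKac (v := z) fun hzKa => by
        have := hamax z hzKa
        have := (haz' hne).2
        omega
      exact ⟨b, hb, fun _ => hbz⟩
  have hba : a ≠ z → G.Adj b a ∧ i b < i a := fun hne =>
    hatop b hbK fun hba => hb hne (hba ▸ (haz' hne).1)
  obtain ⟨-, Kb, hKb, hKbc, hbKb, hbmax⟩ := hKa hbK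
  have hbtop := tops Kb hKb hKbc.isClique b hbKb hbmax
  obtain ⟨e, heK, he⟩ : ∃ e ∈ Kb, a ≠ z → ¬ G.Adj e a := by
    by_cases hne : a = z
    · exact ⟨b, hbKb, fun h => absurd hne h⟩
    · obtain ⟨e, he, hea⟩ := exists_not_adj_of_isNClique hKbc (v := a) fun haKb => by
        have := hbmax a haKb
        have := (hba hne).2
        omega
      exact ⟨e, he, fun _ => hea⟩
  have heb : a ≠ z → G.Adj e b ∧ i e < i b := fun hne =>
    hbtop e heK fun heb => he hne (heb ▸ (hba hne).1)
  set F : Finset V := Kz ∪ Ka ∪ Kb with hF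
  have hFH : ∀ u ∈ F, u ∈ H₀ := by
    intro u hu
    rcases Finset.mem_union.1 hu with hu | hu
    · rcases Finset.mem_union.1 hu with hu | hu
      exacts [h₁₀ (hKz hu), h₁₀ (hKa hu)]
    · exact hKb hu
  set U : Finset V := F ∪ F.image par with hU
  have hcard : U.card ≤ 6 * τ := by
    have h1 := Finset.card_union_le F (F.image par)
    have h2 := Finset.card_image_le (s := F) (f := par)
    have h3 := Finset.card_union_le (Kz ∪ Ka) Kb
    have h4 := Finset.card_union_le Kz Ka
    have h5 := hT.card_clique_le hρ hKzc.isClique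
    have h6 := hT.card_clique_le hρ hKac.isClique
    have h7 := hT.card_clique_le hρ hKbc.isClique
    rw [← hF] at h3
    rw [← hU] at h1
    omega
  have hzF : z ∈ F := by simp [hF, hzK]
  have haF : a ∈ F := by simp [hF, haK]
  have hFU : F ⊆ U := Finset.subset_union_left
  obtain ⟨m, B', hzm, hB'H, hcent, hB'col, hfar⟩ := hT.exists_far (c := c) hρ (hFU hzF)
    fun hc => hX (hc.mono subset_rfl (Nat.add_le_add_left (Nat.mul_le_mul_right τ hcard) _))
  have hmH : m ∈ H₂ := hB'H hcent.1
  have hmF : m ∉ F := fun hmF => (hfar m (hFU hmF) m hcent.1).1 rfl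
  have hH₂L : ∀ u ∈ H₂, u ∈ L := fun u hu => hH₀ (h₁₀ (h₂₁ hu))
  have hB'L : ∀ w ∈ B', w ∈ B ∧ d w = k := fun w hw => hH₂L w (hB'H hw)
  have leads : ∀ v l, InducedPath G v l m → v ∈ B → d v = k - 1 →
      (∀ w ∈ l, w ∈ L) → (∀ u ∈ v :: l, u = m ∨ u ∈ U) →
      Leads G x m (l.length + (k - 1)) B B' := by
    intro v l hp hv hdv hl hlU
    obtain ⟨l', e₁, e₂, e₃⟩ := hd.exists_prepend hp hv fun w hw => ⟨(hl w hw).1, by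
      have := (hl w hw).2
      omega⟩
    refine ⟨l', e₁, by rw [e₂, hdv], fun u hu => ?_, fun u hu hum => ?_⟩
    · rcases e₃ u hu with hu | hu
      · rcases List.mem_cons.1 hu with rfl | hu
        exacts [hv, (hl u hu).1]
      · exact hu.1
    · rcases e₃ u hu with hu | hu
      · have huU := (hlU u hu).resolve_left hum
        exact ⟨fun huB' => (hfar u huU u huB').1 rfl, fun w hw => (hfar u huU w hw).2⟩
      · refine ⟨fun huB' => ?_, fun w hw _ ha => ?_⟩
        · have := (hB'L u huB').2
          omega
        · have := hd.adj_le w (hB'L w hw).1 u hu.1 ha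
          have := (hB'L w hw).2
          omega
  have hparU : ∀ f ∈ F, par f ∈ U := fun f hf =>
    Finset.mem_union_right _ (Finset.mem_image_of_mem _ hf)
  suffices hcons : ∃ t ≤ 3, Leads G x m (t + k) B B' ∧ Leads G x m (t + 1 + k) B B' by
    obtain ⟨t, ht, ht₁, ht₂⟩ := hcons
    refine ⟨m, B', t + k, by omega, fun w hw => (hB'L w hw).1, ht₁, ?_, hcent, hB'col⟩
    rwa [show t + k + 1 = t + 1 + k by omega]
  refine exists_consecutive (G := G) (i := i) (F := (F : Set V)) (a := a)
    (b := b) (c := e) (m := m) (z := z) (P := fun t => Leads G x m (t + k) B B')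
    (fun u hu => hidx u (hFH u hu) m (h₁₀ (h₂₁ hmH))) ?_ ?_ hmF hzF haF
    (by simp [hF, hbK]) (by simp [hF, heK]) hzm (hamin m ⟨hmH, .inr hzm⟩) ?_ ?_
    fun hne => ⟨(haz' hne).1, (haz' hne).2, (hba hne).1, hb hne, (hba hne).2, (heb hne).1, he hne,
      (heb hne).2⟩
  · intro f hf l hp hl
    have hfL := hH₀ (hFH f hf)
    have hlL : ∀ w ∈ l, w ∈ L := fun w hw => by
      rcases (hl w hw).1 with rfl | hw
      exacts [hH₂L w hmH, hH₀ (hFH w hw)]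
    have := leads (par f) (f :: l) (.cons (hi.adj f hfL) (fun w hw =>
      ⟨hi.not_adj w (hlL w hw) f hfL (hl w hw).2, fun hfw => by
        have h1 := (hpar f hfL).2
        have h2 := (hlL w hw).2
        rw [hfw] at h1
        omega⟩) hp) (hpar f hfL).1 (hpar f hfL).2 (by simpa using ⟨hfL, hlL⟩) (by
        intro u hu
        simp only [List.mem_cons] at hu
        rcases hu with rfl | rfl | hu
        · exact .inr (hparU f hf)
        · exact .inr (hFU hf)
        · exact (hl u hu).1.imp_right fun h => hFU h)
    rwa [List.length_cons, show l.length + 1 + (k - 1) = l.length + k by omega] at this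
  · intro f hf hfm
    have hfL := hH₀ (hFH f hf)
    have hmL := hH₂L m hmH
    have hpe := hi.par_eq f hfL m hmL hfm
    have := leads (par m) [m] (.cons (hi.adj m hmL) (by simp) (.nil _)) (hpar m hmL).1
      (hpar m hmL).2 (by simpa using hmL) (by
        intro u hu
        simp only [List.mem_cons, List.not_mem_nil, or_false] at hu
        rcases hu with rfl | rfl
        · exact .inr (hpe ▸ hparU f hf)
        · exact .inl rfl)
    rwa [List.length_singleton, show 1 + (k - 1) = 0 + k by omega] at this
  · obtain ⟨u, hu, hum⟩ := exists_not_adj_of_isNClique hKzc (v := m) fun h => hmF (by simp [hF, h])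
    exact ⟨u, by simp [hF, hu], hum, hztop u hu⟩
  · obtain ⟨u, hu, hum⟩ := exists_not_adj_of_isNClique hKac (v := m) fun h => hmF (by simp [hF, h])
    exact ⟨u, by simp [hF, hu], hum, hatop u hu⟩

end

theorem Leads.exists_embedding {G : SimpleGraph V} {x y : V} {n : ℕ} {B B' : Set V}
    (h : Leads G x y n B B') : ∃ f : pathGraph (n + 1) ↪g G, f 0 = x ∧ f (Fin.last n) = y ∧
      ∀ u ∈ Set.range f, u ≠ y → ∀ w ∈ B' \ {y}, ¬ G.Adj u w := by
  obtain ⟨l, hl, rfl, -, hsep⟩ := h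
  obtain ⟨f, h₀, h₁, hf⟩ := hl.exists_embedding
  refine ⟨f, h₀, h₁, ?_⟩
  rintro _ ⟨j, rfl⟩ hj w hw
  exact (hsep _ (hf j) hj).2 w hw.1 hw.2

/-- Repeated doubling yields paths of all lengths in an interval. -/
theorem exists_leads_interval (ρ τ : ℕ) (φ : ℕ → ℕ) (hρ : 2 ≤ ρ) (c n : ℕ) :
    ∃ c', ∀ (V : Type) [Finite V] (G : SimpleGraph V) (x : V) (B : Set V), Tame G ρ τ φ →
      Centred G (2 * ρ - 1) x B → ¬ ColorableOn G B c' →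
      ∃ y B' T, T ≤ n * (2 * ρ + 2) ∧ B' ⊆ B ∧ (∀ i ≤ n, Leads G x y (T + i) B B') ∧
        Centred G (2 * ρ - 1) y B' ∧ ¬ ColorableOn G B' c := by
  induction n with
  | zero =>
    refine ⟨c, fun V _ G x B _ hC hB => ⟨x, B, 0, by omega, subset_rfl, fun i hi => ?_, hC, hB⟩⟩
    obtain rfl : i = 0 := by omega
    exact .refl hC.1
  | succ n ih =>
    obtain ⟨c', hc'⟩ := ih
    refine ⟨(2 * ρ - 1 + 1) * (τ * (φ (φ c' + 6 * τ * τ) + τ + τ) + τ),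
      fun V _ G x B hT hC hB => ?_⟩
    obtain ⟨y, B', t, ht, hB', h₁, h₂, hC', hcol⟩ := hC.exists_double (c := c') hT hρ hB
    obtain ⟨y', B'', T, hT', hB'', h₃, h₄⟩ := hc' V G y B' hT hC' hcol
    refine ⟨y', B'', t + T, ?_, hB''.trans hB', fun i hi => ?_, h₄⟩
    · rw [add_mul]
      omega
    · rcases hi.lt_or_eq with hi | rfl
      · rw [add_assoc]
        exact h₁.trans (h₃ i (by omega)) hB' hB''
      · rw [show t + T + (n + 1) = t + 1 + (T + n) by omega]
        exact h₂.trans (h₃ n le_rfl) hB' hB''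

theorem IsBall.centred_univ {G : SimpleGraph V} {ρ : ℕ} {x w : V} (h : IsBall G ρ ({x}ᶜ : Set V))
    (hw : w ≠ x) (hxw : G.Adj x w) : Centred G (2 * ρ + 1) x Set.univ := by
  refine ⟨trivial, fun u _ => ?_⟩
  by_cases hu : u = x
  · subst hu
    exact ⟨0, by omega, .nil trivial⟩
  rcases h with h | ⟨z, hz⟩
  · exact absurd (show w ∈ ({x}ᶜ : Set V) from hw) (by simp [h])
  · have key : ∀ v, v ≠ x → ∃ n ≤ ρ, WalkIn G Set.univ z n v := fun v hv =>
      have ⟨n, hn, hwalk⟩ := WalkIn.of_reachable (hz ⟨v, hv⟩).1 (hz ⟨v, hv⟩).2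
      ⟨n, hn, hwalk.mono (Set.subset_univ _)⟩
    obtain ⟨m, hm, h₁⟩ := key w hw
    obtain ⟨n, hn, h₂⟩ := key u hu
    exact ⟨m + n + 1, by omega, (h₁.symm.trans h₂).cons trivial hxw⟩

theorem stmt15 (φ : ℕ → ℕ) (hφ : Monotone φ) (ρ ℓ τ : ℕ) (hρ : 3 ≤ ρ)
    (hℓ : ρ * (8 * ρ + 6) ≤ ℓ) (c : ℕ) (hc : 1 ≤ c) :
    ∃ c' : ℕ, ∀ (V : Type) [Fintype V] (G : SimpleGraph V) (x : V),
      Controlled ρ φ G →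
      chiRho G (ρ - 1) ≤ (τ : ℕ∞) →
      (∀ Y : Set V, (G.induce Y).cliqueNum < G.cliqueNum →
        (G.induce Y).chromaticNumber ≤ (τ : ℕ∞)) →
      IsBall G ρ ({x}ᶜ : Set V) →
      (∃ w, w ≠ x ∧ G.Adj x w) →
      (c' : ℕ∞) < (G.induce ({x}ᶜ : Set V)).chromaticNumber →
      ∃ (y : V) (C : Set V)
        (P : (i : Fin (2 * ρ + 4)) → (pathGraph (ℓ + (i : ℕ) + 1) ↪g G)),
        IsBall G ρ C ∧
        (∀ i, P i 0 = x ∧ P i (Fin.last (ℓ + (i : ℕ))) = y) ∧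
        (∃ w ∈ C, G.Adj y w) ∧
        (∀ i, ∀ u ∈ Set.range (P i), u ≠ y → ∀ w ∈ C, ¬ G.Adj u w) ∧
        (c : ℕ∞) < (G.induce C).chromaticNumber := by
  have hρ' : 2 ≤ ρ := by omega
  obtain ⟨c₁, hc₁⟩ := exists_leads_isBall ρ τ φ hρ' c (ℓ + 1)
  obtain ⟨c₂, hc₂⟩ := exists_leads_interval ρ τ φ hρ' ((2 * ρ - 1 + 1) * (φ c₁ + τ)) (2 * ρ + 3)
  refine ⟨(2 * ρ + 1 + 1) * (φ c₂ + τ), fun V _ G x h₁ h₂ h₃ hball ⟨w, hw, hxw⟩ hchi => ?_⟩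
  have hT := Tame.of_controlled hφ h₁ h₂ h₃
  rw [← not_le, ← ColorableOn.iff_chromaticNumber_le] at hchi
  obtain ⟨y₁, B₁, t₁, -, ht₁, hB₁, hl₁, hC₁, hcol₁⟩ :=
    (hball.centred_univ hw hxw).exists_single (c := c₂) hT hρ'
      fun h => hchi (h.mono (Set.subset_univ _) le_rfl)
  obtain ⟨y₂, B₂, t₂, ht₂, hB₂, hl₂, hC₂, hcol₂⟩ :=
    hc₂ V G y₁ B₁ hT (hC₁.mono (by omega)) hcol₁
  obtain ⟨y₃, B₃, t₃, -, ht₃, hB₃, hl₃, hC₃, hcol₃⟩ :=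
    hC₂.exists_single (c := c₁) hT hρ' hcol₂
  have hle : t₁ + t₂ + t₃ ≤ ℓ := by
    nlinarith [show t₁ + t₃ + 2 ≤ 4 * ρ by omega]
  obtain ⟨y, B, hB, hl, hball', hnbr, hcol⟩ :=
    hc₁ (ℓ - (t₁ + t₂ + t₃)) (by omega) V G y₃ B₃ hT hC₃ hcol₃
  have hleads : ∀ i : Fin (2 * ρ + 4), Leads G x y (ℓ + i) Set.univ B := fun i => by
    have := ((hl₁.trans (hl₂ i (by omega)) hB₁ hB₂).trans hl₃ (hB₂.trans hB₁) hB₃).trans hl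
      (hB₃.trans (hB₂.trans hB₁)) hB
    rwa [show t₁ + (t₂ + i) + t₃ + (ℓ - (t₁ + t₂ + t₃)) = ℓ + i by omega] at this
  choose P hP₀ hP₁ hP using fun i => (hleads i).exists_embedding
  refine ⟨y, B \ {y}, P, hball', fun i => ⟨hP₀ i, hP₁ i⟩, hnbr, hP, ?_⟩
  rwa [← not_le, ← ColorableOn.iff_chromaticNumber_le]
end
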